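/- arXiv:0806.4329 — 3 statements merged into one kernel-verified Lean document; each statement's English description precedes it below -/
import Mathlib

section
/- Let d ∈ ℕ, k ∈ ℕ, q = 2k, and p ∈ [1,∞] with 2 ≤ q ≤ p'. Let μ be a positive finite Borel measure on ℝ^d and u(t,·) = H_t ∗ μ. Then the quantity Q_{p,q}(t) = t^{(d/2)(1/q − 1/p')} ‖(u(t,·)^{1/p})^∧‖_{L^q(ℝ^d)} is nondecreasing for t > 0. -/
open MeasureTheory Real Filter
open scoped FourierTransform ENNReal Topology

/-- The heat kernel `H_t(x) = t^{-d/2} e^{-π|x|²/t}` on `ℝ^d`. -/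
noncomputable def heatKernel (d : ℕ) (t : ℝ) (x : EuclideanSpace ℝ (Fin d)) : ℝ :=
  t ^ (-(d : ℝ) / 2) * Real.exp (-π * ‖x‖ ^ 2 / t)

/-- The solution `u(t,·) = H_t ∗ μ` of the heat equation with initial datum `μ`. -/
noncomputable def heatEvolution (d : ℕ) (μ : Measure (EuclideanSpace ℝ (Fin d)))
    (t : ℝ) (x : EuclideanSpace ℝ (Fin d)) : ℝ :=
  ∫ y, heatKernel d t (x - y) ∂μ

/-- `Q_{p,q}(t) = t^{(d/2)(1/q - 1/p')} ‖(u(t,·)^{1/p})^∧‖_{L^q(ℝ^d)}`, where `1/p' = 1 - 1/p`. -/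
noncomputable def Q (d : ℕ) (μ : Measure (EuclideanSpace ℝ (Fin d))) (p q t : ℝ) : ℝ :=
  t ^ ((d : ℝ) / 2 * (1 / q - (1 - 1 / p))) *
    (eLpNorm (𝓕 fun x => ((heatEvolution d μ t x ^ (1 / p) : ℝ) : ℂ))
      (ENNReal.ofReal q) volume).toReal

section P4

variable {d : ℕ} {ι : Type*} [Fintype ι]

noncomputable def kU (S : Finset (EuclideanSpace ℝ (Fin d))) (a : EuclideanSpace ℝ (Fin d) → ℝ)
    (t : ℝ) (x : EuclideanSpace ℝ (Fin d)) : ℝ :=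
  ∑ v ∈ S, a v * Real.exp (-π * ‖x - v‖ ^ 2 / t)

noncomputable def kB (S : Finset (EuclideanSpace ℝ (Fin d))) (a : EuclideanSpace ℝ (Fin d) → ℝ)
    (t : ℝ) (i : Fin d) (x : EuclideanSpace ℝ (Fin d)) : ℝ :=
  ∑ v ∈ S, a v * Real.exp (-π * ‖x - v‖ ^ 2 / t) * (x i - v i)

noncomputable def kC (S : Finset (EuclideanSpace ℝ (Fin d))) (a : EuclideanSpace ℝ (Fin d) → ℝ)
    (t : ℝ) (i : Fin d) (x : EuclideanSpace ℝ (Fin d)) : ℝ :=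
  ∑ v ∈ S, a v * Real.exp (-π * ‖x - v‖ ^ 2 / t) * (x i - v i) ^ 2

variable (S : Finset (EuclideanSpace ℝ (Fin d))) (a : EuclideanSpace ℝ (Fin d) → ℝ)

lemma kU_cont (t : ℝ) : Continuous (kU S a t) := by
  unfold kU; fun_prop

lemma kB_cont (t : ℝ) (i : Fin d) : Continuous (kB S a t i) := by
  unfold kB; fun_prop

lemma kC_cont (t : ℝ) (i : Fin d) : Continuous (kC S a t i) := by
  unfold kC; fun_prop

lemma kU_pos (ha : ∀ v ∈ S, 0 ≤ a v) (ha' : ∃ v ∈ S, 0 < a v) (t : ℝ)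
    (x : EuclideanSpace ℝ (Fin d)) : 0 < kU S a t x := by
  obtain ⟨v, hv, hav⟩ := ha'
  exact Finset.sum_pos' (fun w hw => mul_nonneg (ha w hw) (Real.exp_pos _).le)
    ⟨v, hv, mul_pos hav (Real.exp_pos _)⟩

lemma kC_nonneg (ha : ∀ v ∈ S, 0 ≤ a v) (t : ℝ) (i : Fin d)
    (x : EuclideanSpace ℝ (Fin d)) : 0 ≤ kC S a t i x :=
  Finset.sum_nonneg (fun w hw => mul_nonneg (mul_nonneg (ha w hw) (Real.exp_pos _).le) (sq_nonneg _))

lemma kB_sq_le (ha : ∀ v ∈ S, 0 ≤ a v) (t : ℝ) (i : Fin d)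
    (x : EuclideanSpace ℝ (Fin d)) : kB S a t i x ^ 2 ≤ kU S a t x * kC S a t i x := by
  unfold kB kU kC
  apply Finset.sum_sq_le_sum_mul_sum_of_sq_le_mul
  · exact fun w hw => mul_nonneg (ha w hw) (Real.exp_pos _).le
  · exact fun w hw => mul_nonneg (mul_nonneg (ha w hw) (Real.exp_pos _).le) (sq_nonneg _)
  · intro w hw; apply le_of_eq; ring

lemma kC_sum (t : ℝ) (x : EuclideanSpace ℝ (Fin d)) :
    ∑ i, kC S a t i x = ∑ v ∈ S, a v * Real.exp (-π * ‖x - v‖ ^ 2 / t) * ‖x - v‖ ^ 2 := by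
  unfold kC
  rw [Finset.sum_comm]
  refine Finset.sum_congr rfl fun v _ => ?_
  rw [← Finset.mul_sum, EuclideanSpace.real_norm_sq_eq]
  simp

lemma kU_hasDerivAt (t : ℝ) (ht : 0 < t) (x : EuclideanSpace ℝ (Fin d)) :
    HasDerivAt (fun t => kU S a t x) (π / t ^ 2 * ∑ i, kC S a t i x) t := by
  rw [kC_sum, Finset.mul_sum]
  unfold kU
  apply HasDerivAt.fun_sum
  intro v _
  have h1 : HasDerivAt (fun t : ℝ => -π * ‖x - v‖ ^ 2 / t) (π * ‖x - v‖ ^ 2 / t ^ 2) t := by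
    have := (hasDerivAt_inv ht.ne').const_mul (-π * ‖x - v‖ ^ 2)
    simp only [div_eq_mul_inv]
    convert! this using 1
    ring
  convert! (h1.exp.const_mul (a v)) using 1
  ring

lemma norm_shift (z : EuclideanSpace ℝ (Fin d)) (i : Fin d) (r : ℝ) :
    ‖z + r • EuclideanSpace.single i (1 : ℝ)‖ ^ 2 = ‖z‖ ^ 2 + 2 * r * z i + r ^ 2 := by
  rw [norm_add_sq_real, inner_smul_right, norm_smul]
  simp [EuclideanSpace.inner_single_right]
  ring

lemma exp_shift (t : ℝ) (i : Fin d) (q : ℝ) (x v : EuclideanSpace ℝ (Fin d)) :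
    HasDerivAt (fun r : ℝ => Real.exp (-π * ‖x + r • q • EuclideanSpace.single i (1 : ℝ) - v‖ ^ 2 / t))
      (-(2 * π / t) * q * (Real.exp (-π * ‖x - v‖ ^ 2 / t) * (x i - v i))) 0 := by
  have h0 : ∀ r : ℝ, -π * ‖x + r • q • EuclideanSpace.single i (1 : ℝ) - v‖ ^ 2 / t =
      -π / t * (‖x - v‖ ^ 2 + 2 * (r * q) * (x i - v i) + (r * q) ^ 2) := by
    intro r
    have : x + r • q • EuclideanSpace.single i (1 : ℝ) - v
        = (x - v) + (r * q) • EuclideanSpace.single i (1 : ℝ) := by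
      rw [smul_smul]; abel
    rw [this, norm_shift]; simp; ring
  simp_rw [h0]
  have hr : HasDerivAt (fun r : ℝ => r * q) q 0 := by simpa using (hasDerivAt_id (0:ℝ)).mul_const q
  have h1 : HasDerivAt (fun r : ℝ => -π / t * (‖x - v‖ ^ 2 + 2 * (r * q) * (x i - v i) + (r * q) ^ 2))
      (-π / t * (2 * q * (x i - v i))) 0 := by
    have := (((((hr.const_mul 2).mul_const (x i - v i)).const_add (‖x - v‖ ^ 2)).add (hr.pow 2))).const_mul (-π / t)
    convert! this using 1
    simp
  convert! h1.exp using 1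
  simp only [zero_mul, mul_zero]
  ring_nf

lemma coord_shift (i : Fin d) (q : ℝ) (x v : EuclideanSpace ℝ (Fin d)) :
    HasDerivAt (fun r : ℝ => (x + r • q • EuclideanSpace.single i (1 : ℝ)) i - v i) q 0 := by
  simp only [PiLp.add_apply, PiLp.smul_apply, PiLp.single_apply, if_true, smul_eq_mul, mul_one]
  simpa using (((hasDerivAt_id (0:ℝ)).mul_const q).const_add (x i)).sub_const (v i)

lemma kU_shift (t : ℝ) (i : Fin d) (q : ℝ) (x : EuclideanSpace ℝ (Fin d)) :
    HasDerivAt (fun r : ℝ => kU S a t (x + r • q • EuclideanSpace.single i (1 : ℝ)))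
      (-(2 * π / t) * q * kB S a t i x) 0 := by
  unfold kU kB
  rw [Finset.mul_sum]
  apply HasDerivAt.fun_sum
  intro v _
  convert! (exp_shift t i q x v).const_mul (a v) using 1
  ring

lemma kB_shift (t : ℝ) (i : Fin d) (q : ℝ) (x : EuclideanSpace ℝ (Fin d)) :
    HasDerivAt (fun r : ℝ => kB S a t i (x + r • q • EuclideanSpace.single i (1 : ℝ)))
      (q * (kU S a t x - (2 * π / t) * kC S a t i x)) 0 := by
  unfold kU kB kC
  rw [Finset.mul_sum, ← Finset.sum_sub_distrib, Finset.mul_sum]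
  apply HasDerivAt.fun_sum
  intro v _
  convert! ((exp_shift t i q x v).const_mul (a v)).mul (coord_shift i q x v) using 1
  simp
  ring

end P4

section P4b

variable {d : ℕ} {ι : Type*} [Fintype ι]

noncomputable def kD (S : Finset (EuclideanSpace ℝ (Fin d))) (a : EuclideanSpace ℝ (Fin d) → ℝ)
    (t : ℝ) (i : Fin d) (x : EuclideanSpace ℝ (Fin d)) : ℝ :=
  kB S a t i x / kU S a t x

noncomputable def kW (S : Finset (EuclideanSpace ℝ (Fin d))) (a : EuclideanSpace ℝ (Fin d) → ℝ)
    (c : ℝ) (ε : ι → ℝ) (g : EuclideanSpace ℝ (Fin d) → ℝ)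
    (t : ℝ) (x : ι → EuclideanSpace ℝ (Fin d)) : ℝ :=
  Real.exp (c * ∑ l, Real.log (kU S a t (x l))) * g (∑ l, ε l • x l)

noncomputable def kq [DecidableEq ι] (ε : ι → ℝ) (j l : ι) : ℝ :=
  (if l = j then 1 else 0) - ε l * ε j / Fintype.card ι

noncomputable def kp [DecidableEq ι] (ε : ι → ℝ) (j : ι) (i : Fin d) (l : ι) :
    EuclideanSpace ℝ (Fin d) := kq ε j l • EuclideanSpace.single i (1 : ℝ)

variable (S : Finset (EuclideanSpace ℝ (Fin d))) (a : EuclideanSpace ℝ (Fin d) → ℝ)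

lemma kD_cont (ha : ∀ v ∈ S, 0 ≤ a v) (ha' : ∃ v ∈ S, 0 < a v) (t : ℝ) (i : Fin d) :
    Continuous (kD S a t i) :=
  (kB_cont S a t i).div (kU_cont S a t) fun x => (kU_pos S a ha ha' t x).ne'

lemma kW_cont (ha : ∀ v ∈ S, 0 ≤ a v) (ha' : ∃ v ∈ S, 0 < a v) (c : ℝ) (ε : ι → ℝ)
    (g : EuclideanSpace ℝ (Fin d) → ℝ) (hg : Continuous g) (t : ℝ) :
    Continuous (kW S a c ε g t) := by
  unfold kW
  have h1 : ∀ l, Continuous fun x : ι → EuclideanSpace ℝ (Fin d) => Real.log (kU S a t (x l)) :=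
    fun l => ((kU_cont S a t).comp (continuous_apply l)).log fun x => (kU_pos S a ha ha' t _).ne'
  have h2 : Continuous fun x : ι → EuclideanSpace ℝ (Fin d) => ∑ l, Real.log (kU S a t (x l)) :=
    continuous_finsetSum _ fun l _ => h1 l
  fun_prop

lemma kD_shift (ha : ∀ v ∈ S, 0 ≤ a v) (ha' : ∃ v ∈ S, 0 < a v)
    (t : ℝ) (i : Fin d) (q : ℝ) (x : EuclideanSpace ℝ (Fin d)) :
    HasDerivAt (fun r : ℝ => kD S a t i (x + r • q • EuclideanSpace.single i (1 : ℝ)))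
      (q * (1 - (2 * π / t) * (kC S a t i x / kU S a t x - kD S a t i x ^ 2))) 0 := by
  have hU := (kU_pos S a ha ha' t x).ne'
  unfold kD
  refine ((kB_shift S a t i q x).div (kU_shift S a t i q x) (by simpa using hU)).congr_deriv ?_
  simp only [zero_smul, add_zero]
  field_simp
  ring

lemma kq_sum [DecidableEq ι] (ε : ι → ℝ) (hε : ∀ l, ε l ^ 2 = 1) (j : ι) :
    ∑ l, ε l * kq ε j l = 0 := by
  have hm : (Fintype.card ι : ℝ) ≠ 0 := by
    have : Nonempty ι := ⟨j⟩
    exact_mod_cast Fintype.card_ne_zero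
  unfold kq
  have : ∀ l, ε l * ((if l = j then (1:ℝ) else 0) - ε l * ε j / Fintype.card ι)
      = (if l = j then ε l else 0) - ε j / Fintype.card ι := by
    intro l
    have := hε l
    split_ifs <;> linear_combination (-ε j / Fintype.card ι) * this
  simp_rw [this]
  rw [Finset.sum_sub_distrib]
  simp
  field_simp
  simp

lemma kW_shift [DecidableEq ι] (ha : ∀ v ∈ S, 0 ≤ a v) (ha' : ∃ v ∈ S, 0 < a v) (c : ℝ) (ε : ι → ℝ)
    (hε : ∀ l, ε l ^ 2 = 1)
    (g : EuclideanSpace ℝ (Fin d) → ℝ) (t : ℝ) (i : Fin d) (j : ι)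
    (x : ι → EuclideanSpace ℝ (Fin d)) :
    HasDerivAt (fun r : ℝ => kW S a c ε g t (x + r • kp ε j i))
      (kW S a c ε g t x * (-(2 * π * c / t) * ∑ l, kq ε j l * kD S a t i (x l))) 0 := by
  unfold kW
  have h0 : ∀ r : ℝ, (∑ l, ε l • (x + r • kp ε j i) l) = ∑ l, ε l • x l := by
    intro r
    simp only [Pi.add_apply, Pi.smul_apply, kp, smul_add, smul_smul, Finset.sum_add_distrib,
      ← Finset.sum_smul]
    have : ∑ l, ε l * (r * kq ε j l) = r * ∑ l, ε l * kq ε j l := by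
      rw [Finset.mul_sum]; exact Finset.sum_congr rfl fun l _ => by ring
    rw [this, kq_sum ε hε j]; simp
  simp_rw [h0]
  have h1 : HasDerivAt (fun r : ℝ => c * ∑ l, Real.log (kU S a t ((x + r • kp ε j i) l)))
      (c * ∑ l, (-(2 * π / t) * kq ε j l * kB S a t i (x l)) / kU S a t (x l)) 0 := by
    apply HasDerivAt.const_mul
    apply HasDerivAt.fun_sum
    intro l _
    have := (kU_shift S a t i (kq ε j l) (x l)).log (by simpa using (kU_pos S a ha ha' t (x l)).ne')
    exact this.congr_deriv (by simp)
  refine (h1.exp.mul_const _).congr_deriv ?_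
  simp only [zero_smul, add_zero, kD]
  have : ∑ l, (-(2 * π / t) * kq ε j l * kB S a t i (x l)) / kU S a t (x l) =
     -(2 * π / t) * ∑ l, kq ε j l * (kB S a t i (x l) / kU S a t (x l)) := by
    rw [Finset.mul_sum]; exact Finset.sum_congr rfl fun l _ => by ring
  rw [this]; ring

noncomputable def kPsi' [DecidableEq ι] (c : ℝ) (ε : ι → ℝ) (g : EuclideanSpace ℝ (Fin d) → ℝ) (t : ℝ)
    (i : Fin d) (j : ι) (x : ι → EuclideanSpace ℝ (Fin d)) : ℝ :=
  kW S a c ε g t x * (-(2 * π * c / t) * (kD S a t i (x j) * ∑ l, kq ε j l * kD S a t i (x l)) +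
    kq ε j j * (1 - (2 * π / t) * (kC S a t i (x j) / kU S a t (x j) - kD S a t i (x j) ^ 2)))

lemma kPsi_shift [DecidableEq ι] (ha : ∀ v ∈ S, 0 ≤ a v) (ha' : ∃ v ∈ S, 0 < a v) (c : ℝ) (ε : ι → ℝ)
    (hε : ∀ l, ε l ^ 2 = 1)
    (g : EuclideanSpace ℝ (Fin d) → ℝ) (t : ℝ) (i : Fin d) (j : ι)
    (x : ι → EuclideanSpace ℝ (Fin d)) :
    HasLineDerivAt ℝ (fun x => kW S a c ε g t x * kD S a t i (x j))
      (kPsi' S a c ε g t i j x) x (kp ε j i) := by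
  unfold HasLineDerivAt
  refine ((kW_shift S a ha ha' c ε hε g t i j x).mul
    (kD_shift S a ha ha' t i (kq ε j j) (x j))).congr_deriv ?_
  simp only [zero_smul, add_zero, kPsi']
  ring

noncomputable def kWt (c : ℝ) (ε : ι → ℝ) (g : EuclideanSpace ℝ (Fin d) → ℝ) (t : ℝ)
    (x : ι → EuclideanSpace ℝ (Fin d)) : ℝ :=
  kW S a c ε g t x * (c * (π / t ^ 2) * ∑ l, ∑ i, kC S a t i (x l) / kU S a t (x l))

lemma kW_hasDerivAt (ha : ∀ v ∈ S, 0 ≤ a v) (ha' : ∃ v ∈ S, 0 < a v) (c : ℝ) (ε : ι → ℝ)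
    (g : EuclideanSpace ℝ (Fin d) → ℝ) (t : ℝ) (ht : 0 < t)
    (x : ι → EuclideanSpace ℝ (Fin d)) :
    HasDerivAt (fun t : ℝ => kW S a c ε g t x) (kWt S a c ε g t x) t := by
  unfold kWt kW
  have h1 : HasDerivAt (fun t : ℝ => c * ∑ l, Real.log (kU S a t (x l)))
      (c * ∑ l, (π / t ^ 2 * ∑ i, kC S a t i (x l)) / kU S a t (x l)) t := by
    apply HasDerivAt.const_mul
    apply HasDerivAt.fun_sum
    intro l _
    exact (kU_hasDerivAt S a t ht (x l)).log (kU_pos S a ha ha' t (x l)).ne'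
  refine (h1.exp.mul_const _).congr_deriv ?_
  have : ∑ l, (π / t ^ 2 * ∑ i, kC S a t i (x l)) / kU S a t (x l) =
      π / t ^ 2 * ∑ l, ∑ i, kC S a t i (x l) / kU S a t (x l) := by
    rw [Finset.mul_sum]
    refine Finset.sum_congr rfl fun l _ => ?_
    rw [Finset.sum_div .. |>.symm]
    ring
  rw [this]; ring

lemma kq_self [DecidableEq ι] (ε : ι → ℝ) (hε : ∀ l, ε l ^ 2 = 1) (j : ι) :
    kq ε j j = 1 - 1 / Fintype.card ι := by
  have := hε j
  simp only [kq, if_true]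
  rw [← pow_two, this]

/-- The key pointwise inequality. -/
lemma key_pointwise [DecidableEq ι] [Nonempty ι] (ha : ∀ v ∈ S, 0 ≤ a v) (ha' : ∃ v ∈ S, 0 < a v)
    (c : ℝ) (hc0 : 0 ≤ c) (hc : 1 - 1 / (Fintype.card ι : ℝ) ≤ c) (ε : ι → ℝ)
    (hε : ∀ l, ε l ^ 2 = 1)
    (g : EuclideanSpace ℝ (Fin d) → ℝ) (hg : ∀ x, 0 ≤ g x) (t : ℝ) (ht : 0 < t)
    (x : ι → EuclideanSpace ℝ (Fin d)) :
    0 ≤ t * kWt S a c ε g t x - (d : ℝ) / 2 * ((Fintype.card ι : ℝ) - 1) * kW S a c ε g t x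
      + 1 / 2 * ∑ i, ∑ j, kPsi' S a c ε g t i j x := by
  have hm : (0 : ℝ) < Fintype.card ι := by exact_mod_cast Fintype.card_pos
  have hW : 0 ≤ kW S a c ε g t x := mul_nonneg (Real.exp_pos _).le (hg _)
  set W := kW S a c ε g t x with hWdef
  set m : ℝ := (Fintype.card ι : ℝ) with hmdef
  have hq : ∀ i, ∑ j, (kD S a t i (x j) * ∑ l, kq ε j l * kD S a t i (x l)) =
      ∑ j, kD S a t i (x j) ^ 2 - (∑ j, ε j * kD S a t i (x j)) ^ 2 / m := by
    intro i
    have : ∀ j, ∑ l, kq ε j l * kD S a t i (x l) = kD S a t i (x j) -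
        ε j / m * ∑ l, ε l * kD S a t i (x l) := by
      intro j
      simp only [kq, sub_mul, Finset.sum_sub_distrib, Finset.mul_sum]
      congr 1
      · simp
      · exact Finset.sum_congr rfl fun l _ => by ring
    simp_rw [this, mul_sub, Finset.sum_sub_distrib]
    congr 1
    · exact Finset.sum_congr rfl fun l _ => by ring
    · rw [pow_two, ← mul_div_assoc' , Finset.sum_mul]
      refine Finset.sum_congr rfl fun l _ => by ring
  have e1 : ∑ i, ∑ j, kPsi' S a c ε g t i j x = W * (∑ i,
      (-(2 * π * c / t) * (∑ j, kD S a t i (x j) ^ 2 - (∑ j, ε j * kD S a t i (x j)) ^ 2 / m)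
       + (1 - 1 / m) * (m - (2 * π / t) *
          (∑ j, kC S a t i (x j) / kU S a t (x j) - ∑ j, kD S a t i (x j) ^ 2)))) := by
    rw [Finset.mul_sum]
    refine Finset.sum_congr rfl fun i _ => ?_
    rw [← hq i]
    simp only [kPsi', ← hWdef, kq_self ε hε]
    rw [← Finset.mul_sum, Finset.sum_add_distrib, ← Finset.mul_sum, ← Finset.mul_sum,
      Finset.sum_sub_distrib, ← Finset.mul_sum, Finset.sum_sub_distrib]
    simp [hmdef]
  have e2 : kWt S a c ε g t x = W * (c * (π / t ^ 2) * ∑ i, ∑ j, kC S a t i (x j) / kU S a t (x j)) := by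
    rw [Finset.sum_comm]; rfl
  rw [e1, e2]
  have e3 : t * (W * (c * (π / t ^ 2) * ∑ i, ∑ j, kC S a t i (x j) / kU S a t (x j))) -
      (d : ℝ) / 2 * (m - 1) * W + 1 / 2 * (W * (∑ i,
      (-(2 * π * c / t) * (∑ j, kD S a t i (x j) ^ 2 - (∑ j, ε j * kD S a t i (x j)) ^ 2 / m)
       + (1 - 1 / m) * (m - (2 * π / t) *
          (∑ j, kC S a t i (x j) / kU S a t (x j) - ∑ j, kD S a t i (x j) ^ 2))))) =
      W * ∑ i, ((π / t) * (c - (1 - 1 / m)) *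
        (∑ j, kC S a t i (x j) / kU S a t (x j) - ∑ j, kD S a t i (x j) ^ 2)
        + π * c / t * ((∑ j, ε j * kD S a t i (x j)) ^ 2 / m)) := by
    have hd : (d : ℝ) / 2 * (m - 1) = ∑ i : Fin d, (m - 1) / 2 := by
      simp; ring
    rw [hd]
    have : ∀ A B C D' : ℝ, t * (W * (c * (π / t ^ 2) * A)) - B * W + 1 / 2 * (W * C) =
      W * ((c * (π / t)) * A - B + 1 / 2 * C) := by
      intros; field_simp
    rw [this _ _ _ 0]
    congr 1
    rw [Finset.mul_sum, ← Finset.sum_sub_distrib, Finset.mul_sum, ← Finset.sum_add_distrib]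
    refine Finset.sum_congr rfl fun i _ => ?_
    field_simp
    ring
  rw [e3]
  refine mul_nonneg hW (Finset.sum_nonneg fun i _ => add_nonneg (mul_nonneg (mul_nonneg (by positivity) (by linarith)) ?_) (by positivity))
  rw [← Finset.sum_sub_distrib]
  refine Finset.sum_nonneg fun j _ => ?_
  have hU := kU_pos S a ha ha' t (x j)
  rw [kD, div_pow, sub_nonneg, div_le_div_iff₀ (by positivity) hU]
  have := mul_le_mul_of_nonneg_left (kB_sq_le S a ha t i (x j)) hU.le
  nlinarith
end P4b

section P4c

variable {d : ℕ} {ι : Type*} [Fintype ι]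

lemma integrable_gaussE (δ : ℝ) (hδ : 0 < δ) :
    Integrable (fun x : EuclideanSpace ℝ (Fin d) => Real.exp (-δ * ‖x‖ ^ 2)) := by
  have := (GaussianFourier.integrable_cexp_neg_mul_sq_norm_add (V := EuclideanSpace ℝ (Fin d))
    (b := (δ : ℂ)) (by simpa using hδ) 0 0).re
  refine this.congr (Filter.Eventually.of_forall fun x => ?_)
  simp only [zero_mul, add_zero]
  rw [show -(δ : ℂ) * (‖x‖ : ℂ) ^ 2 = ((-δ * ‖x‖ ^ 2 : ℝ) : ℂ) by push_cast; ring, ← Complex.ofReal_exp]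
  exact Complex.ofReal_re _

lemma integrable_gaussPi (δ : ℝ) (hδ : 0 < δ) :
    Integrable (fun x : ι → EuclideanSpace ℝ (Fin d) => Real.exp (-δ * ∑ l, ‖x l‖ ^ 2)) := by
  have := Integrable.fintype_prod (ι := ι) (f := fun _ => fun x : EuclideanSpace ℝ (Fin d) =>
    Real.exp (-δ * ‖x‖ ^ 2)) (fun _ => integrable_gaussE δ hδ)
  refine this.congr (Filter.Eventually.of_forall fun x => ?_)
  simp only []
  rw [← Real.exp_sum, Finset.mul_sum]

lemma integrable_gaussPoly (δ : ℝ) (hδ : 0 < δ) (A B : ℝ) :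
    Integrable (fun x : ι → EuclideanSpace ℝ (Fin d) =>
      (A + B * ∑ l, ‖x l‖ ^ 2) * Real.exp (-δ * ∑ l, ‖x l‖ ^ 2)) := by
  have h := (integrable_gaussPi (d := d) (ι := ι) (δ / 2) (by positivity)).const_mul (|A| + |B| * (2 / δ))
  refine h.mono' (by fun_prop) (Filter.Eventually.of_forall fun x => ?_)
  set N := ∑ l, ‖x l‖ ^ 2
  have hN : 0 ≤ N := Finset.sum_nonneg fun _ _ => by positivity
  have e : Real.exp (-δ * N) = Real.exp (-(δ / 2) * N) * Real.exp (-(δ / 2) * N) := by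
    rw [← Real.exp_add]; ring_nf
  have h1 : N * Real.exp (-(δ / 2) * N) ≤ 2 / δ := by
    have := Real.add_one_le_exp (δ / 2 * N)
    rw [show -(δ / 2) * N = -(δ / 2 * N) by ring, Real.exp_neg]
    rw [← div_eq_mul_inv, div_le_iff₀ (Real.exp_pos _)]
    calc N = 2 / δ * (δ / 2 * N) := by field_simp
      _ ≤ _ := by gcongr; linarith
  have h2 : Real.exp (-(δ / 2) * N) ≤ 1 := by
    apply Real.exp_le_one_iff.2; nlinarith
  rw [Real.norm_eq_abs, abs_mul, abs_of_pos (Real.exp_pos _), e, ← mul_assoc]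
  gcongr
  calc |A + B * N| * Real.exp (-(δ / 2) * N) ≤ (|A| + |B| * N) * Real.exp (-(δ / 2) * N) := by
        gcongr
        exact (abs_add_le _ _).trans (by rw [abs_mul, abs_of_nonneg hN])
    _ = |A| * Real.exp (-(δ / 2) * N) + |B| * (N * Real.exp (-(δ / 2) * N)) := by ring
    _ ≤ |A| * 1 + |B| * (2 / δ) := by gcongr
    _ = _ := by ring

end P4c

section P4d

variable {d : ℕ} {ι : Type*} [Fintype ι]
variable (S : Finset (EuclideanSpace ℝ (Fin d))) (a : EuclideanSpace ℝ (Fin d) → ℝ)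

lemma kU_le (ha : ∀ v ∈ S, 0 ≤ a v) (R : ℝ) (hR : ∀ v ∈ S, ‖v‖ ≤ R) (t1 t2 t : ℝ) (ht1 : 0 < t1)
    (h1 : t1 ≤ t) (h2 : t ≤ t2) (x : EuclideanSpace ℝ (Fin d)) :
    kU S a t x ≤ (∑ v ∈ S, a v * Real.exp (π * R ^ 2 / t1)) * Real.exp (-π * ‖x‖ ^ 2 / (2 * t2)) := by
  unfold kU
  rw [Finset.sum_mul]
  refine Finset.sum_le_sum fun v hv => ?_
  rw [mul_assoc, ← Real.exp_add]
  refine mul_le_mul_of_nonneg_left (Real.exp_le_exp.2 ?_) (ha v hv)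
  have ht : 0 < t := by linarith
  have hxv : ‖x‖ ^ 2 / 2 - R ^ 2 ≤ ‖x - v‖ ^ 2 := by
    have h3 : ‖x‖ ≤ ‖x - v‖ + R := by
      calc ‖x‖ = ‖(x - v) + v‖ := by simp
        _ ≤ _ := (norm_add_le _ _).trans (by linarith [hR v hv])
    have : ‖x‖ ^ 2 ≤ (‖x - v‖ + R) ^ 2 := by gcongr
    nlinarith [sq_nonneg (‖x - v‖ - R)]
  have h4 : -π * ‖x - v‖ ^ 2 / t ≤ π * R ^ 2 / t + -π * ‖x‖ ^ 2 / (2 * t) := by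
    rw [show π * R ^ 2 / t + -π * ‖x‖ ^ 2 / (2 * t) = -(π * (‖x‖ ^ 2 / 2 - R ^ 2) / t) by field_simp; ring,
      show -π * ‖x - v‖ ^ 2 / t = -(π * ‖x - v‖ ^ 2 / t) by ring]
    apply neg_le_neg
    have := pi_pos
    gcongr
  refine h4.trans (add_le_add ?_ ?_)
  · have := pi_pos; gcongr
  · rw [neg_mul, neg_div, neg_div]
    apply neg_le_neg
    have := pi_pos; gcongr

lemma kC_div_le (ha : ∀ v ∈ S, 0 ≤ a v) (ha' : ∃ v ∈ S, 0 < a v) (R : ℝ) (hR : ∀ v ∈ S, ‖v‖ ≤ R)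
    (t : ℝ) (i : Fin d) (x : EuclideanSpace ℝ (Fin d)) :
    kC S a t i x / kU S a t x ≤ (‖x‖ + R) ^ 2 := by
  rw [div_le_iff₀ (kU_pos S a ha ha' t x)]
  unfold kC kU
  rw [Finset.mul_sum]
  refine Finset.sum_le_sum fun v hv => ?_
  rw [mul_comm]
  refine mul_le_mul_of_nonneg_right ?_ (mul_nonneg (ha v hv) (Real.exp_pos _).le)
  have h1 : |x i - v i| ≤ ‖x‖ + R := by
    have := PiLp.norm_apply_le (x - v) i
    rw [Real.norm_eq_abs] at this
    refine this.trans ((norm_sub_le _ _).trans (by linarith [hR v hv]))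
  rw [← sq_abs]
  gcongr

lemma kD_sq_le (ha : ∀ v ∈ S, 0 ≤ a v) (ha' : ∃ v ∈ S, 0 < a v)
    (t : ℝ) (i : Fin d) (x : EuclideanSpace ℝ (Fin d)) :
    kD S a t i x ^ 2 ≤ kC S a t i x / kU S a t x := by
  have hU := kU_pos S a ha ha' t x
  rw [kD, div_pow, div_le_div_iff₀ (by positivity) hU]
  have := mul_le_mul_of_nonneg_left (kB_sq_le S a ha t i x) hU.le
  nlinarith

lemma kW_le (ha : ∀ v ∈ S, 0 ≤ a v) (ha' : ∃ v ∈ S, 0 < a v) (c : ℝ) (hc : 0 < c) (ε : ι → ℝ)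
    (g : EuclideanSpace ℝ (Fin d) → ℝ) (hg0 : ∀ x, 0 ≤ g x) (hg1 : ∀ x, g x ≤ 1)
    (t1 t2 : ℝ) (ht1 : 0 < t1) (ht2 : 0 < t2) :
    ∃ K > 0, ∀ t, t1 ≤ t → t ≤ t2 → ∀ x : ι → EuclideanSpace ℝ (Fin d),
      kW S a c ε g t x ≤ K * Real.exp (-(c * π / (2 * t2)) * ∑ l, ‖x l‖ ^ 2) := by
  obtain ⟨R, hR⟩ : ∃ R : ℝ, ∀ v ∈ S, ‖v‖ ≤ R := by
    refine ⟨∑ v ∈ S, ‖v‖, fun v hv => Finset.single_le_sum (f := fun v => ‖v‖) (fun _ _ => norm_nonneg _) hv⟩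
  set A := ∑ v ∈ S, a v * Real.exp (π * R ^ 2 / t1) with hA
  refine ⟨Real.exp (c * ∑ _l : ι, Real.log A), Real.exp_pos _, fun t h1 h2 x => ?_⟩
  have hApos : 0 < A := by
    obtain ⟨v, hv, hav⟩ := ha'
    exact Finset.sum_pos' (fun w hw => mul_nonneg (ha w hw) (Real.exp_pos _).le)
      ⟨v, hv, mul_pos hav (Real.exp_pos _)⟩
  unfold kW
  calc _ ≤ Real.exp (c * ∑ l, Real.log (kU S a t (x l))) * 1 := by gcongr; exact hg1 _
    _ ≤ _ := by
      rw [mul_one, ← Real.exp_add]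
      apply Real.exp_le_exp.2
      have : ∀ l, Real.log (kU S a t (x l)) ≤ Real.log A + (-π * ‖x l‖ ^ 2 / (2 * t2)) := by
        intro l
        rw [← Real.log_exp (-π * ‖x l‖ ^ 2 / (2 * t2)), ← Real.log_mul hApos.ne' (Real.exp_pos _).ne']
        exact Real.log_le_log (kU_pos S a ha ha' t _) (kU_le S a ha R hR t1 t2 t ht1 h1 h2 _)
      calc c * ∑ l, Real.log (kU S a t (x l)) ≤ c * ∑ l, (Real.log A + (-π * ‖x l‖ ^ 2 / (2 * t2))) := by
            gcongr; exact this _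
        _ = _ := by
          rw [Finset.sum_add_distrib, mul_add]
          congr 1
          rw [Finset.mul_sum, Finset.mul_sum]
          exact Finset.sum_congr rfl fun l _ => by ring

lemma T_le (R : ℝ) (x : ι → EuclideanSpace ℝ (Fin d)) :
    ∑ l, (‖x l‖ + R) ^ 2 ≤ 2 * Fintype.card ι * R ^ 2 + 2 * ∑ l, ‖x l‖ ^ 2 := by
  calc _ ≤ ∑ l, (2 * R ^ 2 + 2 * ‖x l‖ ^ 2) := by
        gcongr with l; nlinarith [sq_nonneg (‖x l‖ - R)]
    _ = _ := by rw [Finset.sum_add_distrib, Finset.mul_sum]; simp; ring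

/-- Everything bounded by `W * (A + B * N)` is integrable. -/
lemma integrable_of_W (ha : ∀ v ∈ S, 0 ≤ a v) (ha' : ∃ v ∈ S, 0 < a v) (c : ℝ) (hc : 0 < c) (ε : ι → ℝ)
    (g : EuclideanSpace ℝ (Fin d) → ℝ) (hg0 : ∀ x, 0 ≤ g x) (hg1 : ∀ x, g x ≤ 1)
    (t : ℝ) (ht : 0 < t) (F : (ι → EuclideanSpace ℝ (Fin d)) → ℝ) (hF : Continuous F)
    (R A B : ℝ) (hA : 0 ≤ A) (hB : 0 ≤ B)
    (h : ∀ x, |F x| ≤ kW S a c ε g t x * (A + B * ∑ l, (‖x l‖ + R) ^ 2)) : Integrable F := by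
  obtain ⟨K, hK, hW⟩ := kW_le S a ha ha' c hc ε g hg0 hg1 t t ht ht
  have := (integrable_gaussPoly (d := d) (ι := ι) (c * π / (2 * t)) (by positivity)
    (A + B * (2 * Fintype.card ι * R ^ 2)) (B * 2)).const_mul K
  refine this.mono' hF.aestronglyMeasurable (Filter.Eventually.of_forall fun x => (h x).trans ?_)
  have h1 := hW t le_rfl le_rfl x
  have h2 := T_le R x
  have h3 : A + B * ∑ l, (‖x l‖ + R) ^ 2 ≤ A + B * (2 * Fintype.card ι * R ^ 2) + B * 2 * ∑ l, ‖x l‖ ^ 2 := by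
    nlinarith
  calc _ ≤ (K * Real.exp (-(c * π / (2 * t)) * ∑ l, ‖x l‖ ^ 2)) *
      (A + B * (2 * Fintype.card ι * R ^ 2) + B * 2 * ∑ l, ‖x l‖ ^ 2) := by
        apply mul_le_mul h1 h3 (by positivity) (by positivity)
    _ = _ := by ring

lemma kPsi'_cont [DecidableEq ι] (ha : ∀ v ∈ S, 0 ≤ a v) (ha' : ∃ v ∈ S, 0 < a v) (c : ℝ) (ε : ι → ℝ)
    (g : EuclideanSpace ℝ (Fin d) → ℝ) (hg : Continuous g) (t : ℝ) (i : Fin d) (j : ι) :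
    Continuous (kPsi' S a c ε g t i j) := by
  have h1 := kW_cont S a ha ha' c ε g hg t
  have h2 : ∀ l : ι, Continuous fun x : ι → EuclideanSpace ℝ (Fin d) => kD S a t i (x l) :=
    fun l => (kD_cont S a ha ha' t i).comp (continuous_apply l)
  have h3 : Continuous fun x : ι → EuclideanSpace ℝ (Fin d) => kC S a t i (x j) / kU S a t (x j) :=
    ((kC_cont S a t i).comp (continuous_apply j)).div ((kU_cont S a t).comp (continuous_apply j))
      fun x => (kU_pos S a ha ha' t _).ne'
  have h4 : Continuous fun x : ι → EuclideanSpace ℝ (Fin d) => ∑ l, kq ε j l * kD S a t i (x l) :=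
    continuous_finsetSum _ fun l _ => continuous_const.mul (h2 l)
  unfold kPsi'
  exact h1.mul ((continuous_const.mul ((h2 j).mul h4)).add (continuous_const.mul
    (continuous_const.sub (continuous_const.mul (h3.sub ((h2 j).pow 2))))))

lemma kWt_cont (ha : ∀ v ∈ S, 0 ≤ a v) (ha' : ∃ v ∈ S, 0 < a v) (c : ℝ) (ε : ι → ℝ)
    (g : EuclideanSpace ℝ (Fin d) → ℝ) (hg : Continuous g) (t : ℝ) :
    Continuous (kWt S a c ε g t) := by
  have h1 := kW_cont S a ha ha' c ε g hg t
  have h3 : ∀ (j : ι) (i : Fin d), Continuous fun x : ι → EuclideanSpace ℝ (Fin d) => kC S a t i (x j) / kU S a t (x j) :=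
    fun j i => ((kC_cont S a t i).comp (continuous_apply j)).div ((kU_cont S a t).comp (continuous_apply j))
      fun x => (kU_pos S a ha ha' t _).ne'
  unfold kWt
  exact h1.mul (continuous_const.mul (continuous_finsetSum _ fun l _ => continuous_finsetSum _ fun i _ => h3 l i))

lemma kq_abs_le [DecidableEq ι] (ε : ι → ℝ) (hε : ∀ l, ε l ^ 2 = 1) (j l : ι) : |kq ε j l| ≤ 2 := by
  have hm : (1 : ℝ) ≤ Fintype.card ι := by
    have : Nonempty ι := ⟨j⟩
    exact_mod_cast Fintype.card_pos
  have h1 : ∀ l, |ε l| = 1 := fun l => by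
    rw [← pow_left_inj₀ (abs_nonneg _) zero_le_one two_ne_zero, sq_abs, hε l]; simp
  have h2 : |ε l * ε j / Fintype.card ι| ≤ 1 := by
    rw [abs_div, abs_mul, h1, h1, Nat.abs_cast, div_le_one (by linarith)]; linarith
  unfold kq
  refine (abs_sub _ _).trans ?_
  have h3 : |(if l = j then (1 : ℝ) else 0)| ≤ 1 := by split_ifs <;> simp
  linarith

lemma integral_kPsi' [DecidableEq ι] (ha : ∀ v ∈ S, 0 ≤ a v) (ha' : ∃ v ∈ S, 0 < a v)
    (c : ℝ) (hc : 0 < c) (ε : ι → ℝ) (hε : ∀ l, ε l ^ 2 = 1)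
    (g : EuclideanSpace ℝ (Fin d) → ℝ) (hg : Continuous g) (hg0 : ∀ x, 0 ≤ g x) (hg1 : ∀ x, g x ≤ 1)
    (t : ℝ) (ht : 0 < t) (i : Fin d) (j : ι) :
    Integrable (kPsi' S a c ε g t i j) ∧ ∫ x, kPsi' S a c ε g t i j x = 0 := by
  obtain ⟨R, hR⟩ : ∃ R : ℝ, ∀ v ∈ S, ‖v‖ ≤ R := by
    refine ⟨∑ v ∈ S, ‖v‖, fun v hv => Finset.single_le_sum (f := fun v => ‖v‖) (fun _ _ => norm_nonneg _) hv⟩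
  have hW0 : ∀ x, 0 ≤ kW S a c ε g t x := fun x => mul_nonneg (Real.exp_pos _).le (hg0 _)
  have hT : ∀ (x : ι → EuclideanSpace ℝ (Fin d)) l, (‖x l‖ + R) ^ 2 ≤ ∑ l, (‖x l‖ + R) ^ 2 := fun x l =>
    Finset.single_le_sum (f := fun l => (‖x l‖ + R) ^ 2) (fun _ _ => sq_nonneg _) (Finset.mem_univ l)
  have hC : ∀ (x : ι → EuclideanSpace ℝ (Fin d)) l, kC S a t i (x l) / kU S a t (x l) ≤ ∑ l, (‖x l‖ + R) ^ 2 :=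
    fun x l => (kC_div_le S a ha ha' R hR t i (x l)).trans (hT x l)
  have hD : ∀ (x : ι → EuclideanSpace ℝ (Fin d)) l, kD S a t i (x l) ^ 2 ≤ ∑ l, (‖x l‖ + R) ^ 2 :=
    fun x l => (kD_sq_le S a ha ha' t i (x l)).trans (hC x l)
  have hDD : ∀ (x : ι → EuclideanSpace ℝ (Fin d)) l l', |kD S a t i (x l) * kD S a t i (x l')| ≤ ∑ l, (‖x l‖ + R) ^ 2 := by
    intro x l l'
    rw [abs_le]
    constructor
    · nlinarith [hD x l, hD x l', sq_nonneg (kD S a t i (x l) + kD S a t i (x l'))]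
    · nlinarith [hD x l, hD x l', sq_nonneg (kD S a t i (x l) - kD S a t i (x l'))]
  have hI' : Integrable (kPsi' S a c ε g t i j) := by
    refine integrable_of_W S a ha ha' c hc ε g hg0 hg1 t ht _ (kPsi'_cont S a ha ha' c ε g hg t i j)
      R 2 (2 * π * c / t * (2 * Fintype.card ι) + 2 * (2 * π / t)) (by positivity) (by positivity) fun x => ?_
    unfold kPsi'
    rw [abs_mul, abs_of_nonneg (hW0 x)]
    refine mul_le_mul_of_nonneg_left ?_ (hW0 x)
    set T := ∑ l, (‖x l‖ + R) ^ 2 with hTdef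
    have e1 : |kD S a t i (x j) * ∑ l, kq ε j l * kD S a t i (x l)| ≤ 2 * Fintype.card ι * T := by
      rw [Finset.mul_sum]
      refine (Finset.abs_sum_le_sum_abs _ _).trans ?_
      calc _ ≤ ∑ l : ι, 2 * T := by
            refine Finset.sum_le_sum fun l _ => ?_
            rw [show kD S a t i (x j) * (kq ε j l * kD S a t i (x l)) = kq ε j l * (kD S a t i (x j) * kD S a t i (x l)) by ring, abs_mul]
            exact mul_le_mul (kq_abs_le ε hε j l) (hDD x j l) (abs_nonneg _) (by norm_num)
        _ = _ := by simp; ring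
    have e2 : |1 - (2 * π / t) * (kC S a t i (x j) / kU S a t (x j) - kD S a t i (x j) ^ 2)| ≤ 1 + 2 * π / t * T := by
      have h1 : 0 ≤ kC S a t i (x j) / kU S a t (x j) - kD S a t i (x j) ^ 2 := sub_nonneg.2 (kD_sq_le S a ha ha' t i (x j))
      have h2 : kC S a t i (x j) / kU S a t (x j) - kD S a t i (x j) ^ 2 ≤ T := by
        have := hC x j; nlinarith [sq_nonneg (kD S a t i (x j))]
      refine (abs_sub _ _).trans ?_
      rw [abs_one, abs_mul, abs_of_nonneg h1, abs_of_nonneg (by positivity)]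
      gcongr
    refine (abs_add_le _ _).trans ?_
    rw [abs_mul (-(2 * π * c / t)), abs_mul (kq ε j j), abs_neg, abs_of_nonneg (by positivity : (0:ℝ) ≤ 2 * π * c / t)]
    have e3 : |kq ε j j| * |1 - (2 * π / t) * (kC S a t i (x j) / kU S a t (x j) - kD S a t i (x j) ^ 2)| ≤ 2 * (1 + 2 * π / t * T) :=
      mul_le_mul (kq_abs_le ε hε j j) e2 (abs_nonneg _) (by norm_num)
    have e4 := mul_le_mul_of_nonneg_left e1 (by positivity : (0:ℝ) ≤ 2 * π * c / t)
    linarith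
  have hI : Integrable (fun x : ι → EuclideanSpace ℝ (Fin d) => kW S a c ε g t x * kD S a t i (x j)) := by
    refine integrable_of_W S a ha ha' c hc ε g hg0 hg1 t ht _ ((kW_cont S a ha ha' c ε g hg t).mul
      ((kD_cont S a ha ha' t i).comp (continuous_apply j)))
      R 1 1 (by positivity) (by positivity) fun x => ?_
    rw [abs_mul, abs_of_nonneg (hW0 x)]
    refine mul_le_mul_of_nonneg_left ?_ (hW0 x)
    have := hD x j
    rw [abs_le]; constructor <;> nlinarith [sq_nonneg (kD S a t i (x j) + 1), sq_nonneg (kD S a t i (x j) - 1)]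
  refine ⟨hI', ?_⟩
  have := integral_bilinear_hasLineDerivAt_right_eq_neg_left_of_integrable
    (μ := (volume : Measure (ι → EuclideanSpace ℝ (Fin d)))) (B := ContinuousLinearMap.mul ℝ ℝ)
    (f := fun _ => (1 : ℝ)) (f' := fun _ => 0)
    (g := fun x => kW S a c ε g t x * kD S a t i (x j)) (g' := kPsi' S a c ε g t i j) (v := kp ε j i)
    (by simp) (by simpa using hI') (by simpa using hI)
    (fun x _ => by simpa [HasLineDerivAt] using hasDerivAt_const (0:ℝ) (1:ℝ))
    (fun x _ => kPsi_shift S a ha ha' c ε hε g t i j x)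
  simpa using this

lemma kW_integrable (ha : ∀ v ∈ S, 0 ≤ a v) (ha' : ∃ v ∈ S, 0 < a v)
    (c : ℝ) (hc : 0 < c) (ε : ι → ℝ)
    (g : EuclideanSpace ℝ (Fin d) → ℝ) (hg : Continuous g) (hg0 : ∀ x, 0 ≤ g x) (hg1 : ∀ x, g x ≤ 1)
    (t : ℝ) (ht : 0 < t) : Integrable (kW S a c ε g t) := by
  refine integrable_of_W S a ha ha' c hc ε g hg0 hg1 t ht _ (kW_cont S a ha ha' c ε g hg t)
      0 1 0 (by positivity) (by positivity) fun x => ?_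
  have hW0 : 0 ≤ kW S a c ε g t x := mul_nonneg (Real.exp_pos _).le (hg0 _)
  rw [abs_of_nonneg hW0]
  simp

set_option maxHeartbeats 1000000 in
lemma kJ_hasDerivAt (ha : ∀ v ∈ S, 0 ≤ a v) (ha' : ∃ v ∈ S, 0 < a v)
    (c : ℝ) (hc : 0 < c) (ε : ι → ℝ)
    (g : EuclideanSpace ℝ (Fin d) → ℝ) (hg : Continuous g) (hg0 : ∀ x, 0 ≤ g x) (hg1 : ∀ x, g x ≤ 1)
    (t : ℝ) (ht : 0 < t) :
    Integrable (kWt (ι := ι) S a c ε g t) ∧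
    HasDerivAt (fun t => ∫ x : ι → EuclideanSpace ℝ (Fin d), kW S a c ε g t x) (∫ x, kWt S a c ε g t x) t := by
  obtain ⟨R, hR⟩ : ∃ R : ℝ, ∀ v ∈ S, ‖v‖ ≤ R := by
    refine ⟨∑ v ∈ S, ‖v‖, fun v hv => Finset.single_le_sum (f := fun v => ‖v‖) (fun _ _ => norm_nonneg _) hv⟩
  obtain ⟨K, hK, hW⟩ := kW_le (ι := ι) S a ha ha' c hc ε g hg0 hg1 (t / 2) (2 * t) (by positivity) (by positivity)
  set B := c * (π / (t / 2) ^ 2) * d with hB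
  have hB0 : 0 ≤ B := by positivity
  have hbd : ∀ x : ι → EuclideanSpace ℝ (Fin d), ∀ s ∈ Set.Ioo (t / 2) (2 * t), ‖kWt S a c ε g s x‖ ≤
      K * ((B * (2 * Fintype.card ι * R ^ 2) + B * 2 * ∑ l, ‖x l‖ ^ 2) *
      Real.exp (-(c * π / (2 * (2 * t))) * ∑ l, ‖x l‖ ^ 2)) := by
    intro x s hs
    have hs0 : 0 < s := by linarith [hs.1]
    have hW0 : 0 ≤ kW S a c ε g s x := mul_nonneg (Real.exp_pos _).le (hg0 _)
    have h0 : 0 ≤ ∑ l, ∑ i, kC S a s i (x l) / kU S a s (x l) := Finset.sum_nonneg fun l _ =>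
      Finset.sum_nonneg fun i _ => div_nonneg (kC_nonneg S a ha s i _) (kU_pos S a ha ha' s _).le
    have h1 : ∑ l, ∑ i, kC S a s i (x l) / kU S a s (x l) ≤ d * ∑ l, (‖x l‖ + R) ^ 2 := by
      rw [Finset.mul_sum]
      refine Finset.sum_le_sum fun l _ => ?_
      calc _ ≤ ∑ i : Fin d, (‖x l‖ + R) ^ 2 := Finset.sum_le_sum fun i _ => kC_div_le S a ha ha' R hR s i (x l)
        _ = _ := by simp
    have h2 := T_le R x
    unfold kWt
    rw [Real.norm_eq_abs, abs_of_nonneg (by positivity)]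
    have h3 : c * (π / s ^ 2) * ∑ l, ∑ i, kC S a s i (x l) / kU S a s (x l) ≤
        B * (2 * Fintype.card ι * R ^ 2) + B * 2 * ∑ l, ‖x l‖ ^ 2 := by
      calc _ ≤ c * (π / (t / 2) ^ 2) * (d * (2 * Fintype.card ι * R ^ 2 + 2 * ∑ l, ‖x l‖ ^ 2)) := by
            have := hs.1
            have := pi_pos
            have := h1.trans (mul_le_mul_of_nonneg_left h2 (Nat.cast_nonneg d))
            gcongr
        _ = _ := by rw [hB]; ring
    calc _ ≤ (K * Real.exp (-(c * π / (2 * (2 * t))) * ∑ l, ‖x l‖ ^ 2)) * (B * (2 * Fintype.card ι * R ^ 2) + B * 2 * ∑ l, ‖x l‖ ^ 2) := by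
          apply mul_le_mul (hW s hs.1.le hs.2.le x) h3 (by positivity) (by positivity)
      _ = _ := by ring
  have hbI : Integrable (fun x : ι → EuclideanSpace ℝ (Fin d) =>
      K * ((B * (2 * Fintype.card ι * R ^ 2) + B * 2 * ∑ l, ‖x l‖ ^ 2) *
      Real.exp (-(c * π / (2 * (2 * t))) * ∑ l, ‖x l‖ ^ 2))) :=
    (integrable_gaussPoly (c * π / (2 * (2 * t))) (by positivity) _ _).const_mul K
  exact hasDerivAt_integral_of_dominated_loc_of_deriv_le (μ := (volume : Measure (ι → EuclideanSpace ℝ (Fin d))))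
    (F := fun s x => kW S a c ε g s x) (F' := fun s x => kWt S a c ε g s x) (x₀ := t) (s := Set.Ioo (t / 2) (2 * t))
    (bound := fun x => K * ((B * (2 * Fintype.card ι * R ^ 2) + B * 2 * ∑ l, ‖x l‖ ^ 2) *
      Real.exp (-(c * π / (2 * (2 * t))) * ∑ l, ‖x l‖ ^ 2)))
    (Ioo_mem_nhds (by linarith) (by linarith))
    (Filter.Eventually.of_forall fun s => (kW_cont S a ha ha' c ε g hg s).aestronglyMeasurable)
    (kW_integrable S a ha ha' c hc ε g hg hg0 hg1 t ht)
    (kWt_cont S a ha ha' c ε g hg t).aestronglyMeasurable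
    (Filter.Eventually.of_forall hbd)
    hbI
    (Filter.Eventually.of_forall fun x s hs =>
      kW_hasDerivAt S a ha ha' c ε g s (by linarith [hs.1]) x)

theorem kJ_mono [Nonempty ι] (ha : ∀ v ∈ S, 0 ≤ a v) (ha' : ∃ v ∈ S, 0 < a v)
    (c : ℝ) (hc : 0 < c) (hcm : 1 - 1 / (Fintype.card ι : ℝ) ≤ c) (ε : ι → ℝ) (hε : ∀ l, ε l ^ 2 = 1)
    (g : EuclideanSpace ℝ (Fin d) → ℝ) (hg : Continuous g) (hg0 : ∀ x, 0 ≤ g x) (hg1 : ∀ x, g x ≤ 1) :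
    MonotoneOn (fun t => t ^ (-((d : ℝ) / 2 * ((Fintype.card ι : ℝ) - 1))) *
      ∫ x : ι → EuclideanSpace ℝ (Fin d), kW S a c ε g t x) (Set.Ioi 0) := by
  classical
  set β := (d : ℝ) / 2 * ((Fintype.card ι : ℝ) - 1) with hβ
  have hder : ∀ t : ℝ, 0 < t → HasDerivAt (fun t => t ^ (-β) *
      ∫ x : ι → EuclideanSpace ℝ (Fin d), kW S a c ε g t x)
      (t ^ (-β) / t * (t * (∫ x, kWt S a c ε g t x) - β * ∫ x : ι → EuclideanSpace ℝ (Fin d), kW S a c ε g t x)) t := by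
    intro t ht
    have h1 := (kJ_hasDerivAt (ι := ι) S a ha ha' c hc ε g hg hg0 hg1 t ht).2
    have h2 := Real.hasDerivAt_rpow_const (x := t) (p := -β) (Or.inl ht.ne')
    refine (h2.mul h1).congr_deriv ?_
    rw [Real.rpow_sub_one ht.ne']
    field_simp
    ring
  refine monotoneOn_of_deriv_nonneg (convex_Ioi 0)
    (fun t ht => (hder t ht).continuousAt.continuousWithinAt) 
    (fun t ht => (hder t (by simpa using ht)).differentiableAt.differentiableWithinAt) ?_
  intro t ht
  rw [interior_Ioi] at ht
  have ht : 0 < t := ht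
  rw [(hder t ht).deriv]
  refine mul_nonneg (by positivity) ?_
  have hP := fun i j => integral_kPsi' S a ha ha' c hc ε hε g hg hg0 hg1 t ht i j
  have hsum : ∫ x : ι → EuclideanSpace ℝ (Fin d), ∑ i, ∑ j, kPsi' S a c ε g t i j x = 0 := by
    rw [integral_finsetSum _ (fun i _ => integrable_finsetSum _ fun j _ => (hP i j).1)]
    refine Finset.sum_eq_zero fun i _ => ?_
    rw [integral_finsetSum _ (fun j _ => (hP i j).1)]
    exact Finset.sum_eq_zero fun j _ => (hP i j).2
  have hsumI : Integrable fun x : ι → EuclideanSpace ℝ (Fin d) => ∑ i, ∑ j, kPsi' S a c ε g t i j x :=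
    integrable_finsetSum _ fun i _ => integrable_finsetSum _ fun j _ => (hP i j).1
  have hWtI := (kJ_hasDerivAt (ι := ι) S a ha ha' c hc ε g hg hg0 hg1 t ht).1
  have hWI := kW_integrable (ι := ι) S a ha ha' c hc ε g hg hg0 hg1 t ht
  have : t * (∫ x, kWt S a c ε g t x) - β * (∫ x : ι → EuclideanSpace ℝ (Fin d), kW S a c ε g t x) =
      ∫ x : ι → EuclideanSpace ℝ (Fin d), (t * kWt S a c ε g t x - β * kW S a c ε g t x
      + 1 / 2 * ∑ i, ∑ j, kPsi' S a c ε g t i j x) := by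
    have hI1 : Integrable fun x : ι → EuclideanSpace ℝ (Fin d) =>
        t * kWt S a c ε g t x - β * kW S a c ε g t x := (hWtI.const_mul t).sub (hWI.const_mul β)
    rw [integral_add hI1 (hsumI.const_mul _),
      integral_sub (hWtI.const_mul t) (hWI.const_mul β), integral_const_mul, integral_const_mul,
      integral_const_mul, hsum]
    ring
  rw [this]
  exact integral_nonneg fun x => key_pointwise S a ha ha' c hc.le hcm ε hε g hg0 t ht x

end P4d

section P2

variable {d : ℕ}

lemma hk_cont (t : ℝ) : Continuous (heatKernel d t) := by
  unfold heatKernel; fun_prop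

lemma hk_pos {t : ℝ} (ht : 0 < t) (x : EuclideanSpace ℝ (Fin d)) : 0 < heatKernel d t x := by
  unfold heatKernel; positivity

lemma hk_le {t : ℝ} (ht : 0 < t) (x : EuclideanSpace ℝ (Fin d)) :
    heatKernel d t x ≤ t ^ (-(d : ℝ) / 2) := by
  unfold heatKernel
  have h1 : Real.exp (-π * ‖x‖ ^ 2 / t) ≤ 1 := by
    apply Real.exp_le_one_iff.2
    apply div_nonpos_of_nonpos_of_nonneg _ ht.le
    have := mul_nonneg Real.pi_pos.le (sq_nonneg ‖x‖)
    linarith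
  have h2 : 0 ≤ t ^ (-(d : ℝ) / 2) := by positivity
  nlinarith

variable (μ : Measure (EuclideanSpace ℝ (Fin d))) [IsFiniteMeasure μ]

lemma hk_integrable {t : ℝ} (ht : 0 < t) (x : EuclideanSpace ℝ (Fin d)) :
    Integrable (fun y => heatKernel d t (x - y)) μ := by
  apply Integrable.of_bound (C := t ^ (-(d : ℝ) / 2))
  · exact ((hk_cont t).comp (by fun_prop)).aestronglyMeasurable
  · refine Eventually.of_forall fun y => ?_
    rw [Real.norm_of_nonneg (hk_pos ht _).le]
    exact hk_le ht _

lemma hu_nonneg {t : ℝ} (ht : 0 < t) (x : EuclideanSpace ℝ (Fin d)) :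
    0 ≤ heatEvolution d μ t x :=
  integral_nonneg fun _ => (hk_pos ht _).le

lemma hu_le {t : ℝ} (ht : 0 < t) (x : EuclideanSpace ℝ (Fin d)) :
    heatEvolution d μ t x ≤ t ^ (-(d : ℝ) / 2) * μ.real Set.univ := by
  unfold heatEvolution
  calc _ ≤ ∫ y, t ^ (-(d : ℝ) / 2) ∂μ :=
        integral_mono (hk_integrable μ ht x) (integrable_const _) fun y => hk_le ht _
    _ = _ := by simp [mul_comm]

lemma hu_cont {t : ℝ} (ht : 0 < t) : Continuous (heatEvolution d μ t) := by
  unfold heatEvolution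
  apply continuous_of_dominated (bound := fun _ => t ^ (-(d : ℝ) / 2))
  · intro x; exact (hk_integrable μ ht x).aestronglyMeasurable
  · intro x
    refine Eventually.of_forall fun y => ?_
    rw [Real.norm_of_nonneg (hk_pos ht _).le]
    exact hk_le ht _
  · exact integrable_const _
  · exact Eventually.of_forall fun y => (hk_cont t).comp (by fun_prop)

lemma summable_pi_prod (h : ℤ → ℝ) (h0 : ∀ n, 0 ≤ h n) (hs : Summable h) :
    ∀ d : ℕ, Summable fun n : Fin d → ℤ => ∏ i, h (n i)
  | 0 => (hasSum_fintype _).summable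
  | (d+1) => by
    rw [← (Fin.consEquiv (fun _ : Fin (d+1) => ℤ)).summable_iff]
    have := Summable.mul_of_nonneg hs (summable_pi_prod h h0 hs d) h0
      (fun n => Finset.prod_nonneg fun i _ => h0 _)
    refine this.congr fun x => ?_
    simp [Fin.prod_univ_succ, Fin.consEquiv]

noncomputable def latV (n : Fin d → ℤ) : EuclideanSpace ℝ (Fin d) :=
  WithLp.toLp 2 (fun i => (n i : ℝ))

lemma lat_summable {b : ℝ} (hb : 0 < b) :
    Summable fun n : Fin d → ℤ => Real.exp (-b * ‖latV n‖ ^ 2) := by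
  have h1 : Summable fun n : ℤ => Real.exp (-b * (n:ℝ) ^ 2) := by
    have := summable_pow_mul_jacobiTheta₂_term_bound 0 (T := b / π) (by positivity) 0
    refine this.congr fun n => ?_
    simp
    field_simp
  refine (summable_pi_prod _ (fun n => (Real.exp_pos _).le) h1 d).congr fun n => ?_
  rw [← Real.exp_sum, EuclideanSpace.real_norm_sq_eq, ← Finset.mul_sum]
  simp [latV]

lemma hk_lat {s t : ℝ} (hs : 0 < s) (ht : 0 < t) :
    ∃ C > 0, ∀ z : EuclideanSpace ℝ (Fin d), ∃ n : Fin d → ℤ,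
      heatKernel d t z ≤ C * Real.exp (-(π / (2 * t)) * ‖latV n‖ ^ 2) *
        heatKernel d s (z - latV n) := by
  refine ⟨t ^ (-(d : ℝ) / 2) * (s ^ (-(d : ℝ) / 2))⁻¹ * Real.exp (π * d / (4 * t) + π * d / (4 * s)),
    by positivity, fun z => ⟨fun i => round (z i), ?_⟩⟩
  set v : EuclideanSpace ℝ (Fin d) := latV fun i => round (z i) with hv
  have h1 : ‖z - v‖ ^ 2 ≤ d / 4 := by
    rw [EuclideanSpace.real_norm_sq_eq]
    calc _ ≤ ∑ i : Fin d, (1 / 4 : ℝ) := by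
          apply Finset.sum_le_sum fun i _ => ?_
          have := abs_sub_round (z i)
          have h2 : (z - v) i = z i - round (z i) := by simp [hv, latV]
          rw [h2, ← sq_abs]
          nlinarith [abs_nonneg (z i - round (z i))]
      _ = _ := by simp; ring
  have h2 : ‖v‖ ^ 2 ≤ 2 * ‖z‖ ^ 2 + d / 2 := by
    have h3 : ‖v‖ ≤ ‖z‖ + ‖z - v‖ := by
      have := norm_sub_le z (z - v)
      simpa using this
    have := norm_nonneg v
    nlinarith [sq_nonneg (‖z‖ - ‖z - v‖)]
  unfold heatKernel
  have e1 : t ^ (-(d : ℝ) / 2) * (s ^ (-(d : ℝ) / 2))⁻¹ *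
      Real.exp (π * d / (4 * t) + π * d / (4 * s)) * Real.exp (-(π / (2 * t)) * ‖v‖ ^ 2) *
      (s ^ (-(d : ℝ) / 2) * Real.exp (-π * ‖z - v‖ ^ 2 / s)) =
      t ^ (-(d : ℝ) / 2) * Real.exp ((π * d / (4 * t) + π * d / (4 * s)) +
        (-(π / (2 * t)) * ‖v‖ ^ 2) + (-π * ‖z - v‖ ^ 2 / s)) := by
    have : s ^ (-(d : ℝ) / 2) ≠ 0 := by positivity
    generalize s ^ (-(d : ℝ) / 2) = S at *
    generalize π * d / (4 * t) + π * d / (4 * s) = X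
    generalize -(π / (2 * t)) * ‖v‖ ^ 2 = Y
    generalize -π * ‖z - v‖ ^ 2 / s = Z
    rw [Real.exp_add, Real.exp_add]
    field_simp
  rw [e1]
  apply mul_le_mul_of_nonneg_left _ (by positivity)
  apply Real.exp_le_exp.2
  have h3 : -π * ‖z - v‖ ^ 2 / s ≥ - (π * d / (4 * s)) := by
    have : π / s * ‖z - v‖ ^ 2 ≤ π / s * (d / 4) := by gcongr
    have e : π / s * (d / 4) = π * d / (4 * s) := by field_simp
    have e' : -π * ‖z - v‖ ^ 2 / s = - (π / s * ‖z - v‖ ^ 2) := by field_simp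
    rw [e']; linarith
  have h4 : π / (2 * t) * ‖v‖ ^ 2 ≤ π / (2 * t) * (2 * ‖z‖ ^ 2 + d / 2) := by gcongr
  have e : π / (2 * t) * (2 * ‖z‖ ^ 2 + d / 2) = π * ‖z‖ ^ 2 / t + π * d / (4 * t) := by
    field_simp; ring
  have e' : -π * ‖z‖ ^ 2 / t = - (π * ‖z‖ ^ 2 / t) := by ring
  rw [e']
  linarith

lemma ennreal_tsum_rpow_le {ι : Type*} (f : ι → ℝ≥0∞) {c : ℝ} (hc : 0 < c) (hc1 : c ≤ 1) :
    (∑' i, f i) ^ c ≤ ∑' i, f i ^ c := by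
  classical
  have h1 : ∀ s : Finset ι, (∑ i ∈ s, f i) ^ c ≤ ∑ i ∈ s, f i ^ c := by
    intro s
    induction s using Finset.induction_on with
    | empty => simp [hc]
    | insert a s ha ih =>
      rw [Finset.sum_insert ha, Finset.sum_insert ha]
      exact (ENNReal.rpow_add_le_add_rpow _ _ hc.le hc1).trans (by gcongr)
  have h2 : Tendsto (fun s : Finset ι => (∑ i ∈ s, f i) ^ c) atTop (𝓝 ((∑' i, f i) ^ c)) :=
    ((ENNReal.continuous_rpow_const (y := c)).tendsto _).comp ENNReal.summable.hasSum
  exact le_of_tendsto' h2 fun s => (h1 s).trans (ENNReal.sum_le_tsum s)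

lemma hu_ofReal {t : ℝ} (ht : 0 < t) (x : EuclideanSpace ℝ (Fin d)) :
    ENNReal.ofReal (heatEvolution d μ t x) = ∫⁻ y, ENNReal.ofReal (heatKernel d t (x - y)) ∂μ :=
  ofReal_integral_eq_lintegral_ofReal (hk_integrable μ ht x)
    (Eventually.of_forall fun _ => (hk_pos ht _).le)

lemma hu_rpow_cont {t : ℝ} (ht : 0 < t) {c : ℝ} (hc : 0 < c) :
    Continuous fun x => heatEvolution d μ t x ^ c :=
  (hu_cont μ ht).rpow_const fun _ => Or.inr hc.le

lemma hu_integrable_iff {t : ℝ} (ht : 0 < t) {c : ℝ} (hc : 0 < c) :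
    Integrable (fun x => heatEvolution d μ t x ^ c) ↔
      ∫⁻ x, ENNReal.ofReal (heatEvolution d μ t x) ^ c < ∞ := by
  rw [Integrable, and_iff_right (hu_rpow_cont μ ht hc).aestronglyMeasurable,
    hasFiniteIntegral_iff_ofReal (Eventually.of_forall fun x => Real.rpow_nonneg (hu_nonneg μ ht x) c)]
  simp_rw [ENNReal.ofReal_rpow_of_nonneg (hu_nonneg μ ht _) hc.le]

lemma hu_integrable_transfer {s t : ℝ} (hs : 0 < s) (ht : 0 < t) {c : ℝ} (hc : 0 < c) (hc1 : c ≤ 1)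
    (h : Integrable (fun x => heatEvolution d μ s x ^ c)) :
    Integrable (fun x => heatEvolution d μ t x ^ c) := by
  rw [hu_integrable_iff μ hs hc] at h
  rw [hu_integrable_iff μ ht hc]
  obtain ⟨C, hC, hCz⟩ := hk_lat (d := d) hs ht
  set A : (Fin d → ℤ) → ℝ := fun n => C * Real.exp (-(π / (2 * t)) * ‖latV n‖ ^ 2) with hA
  have hA0 : ∀ n, 0 < A n := fun n => by positivity
  have h1 : ∀ x, ENNReal.ofReal (heatEvolution d μ t x) ≤
      ∑' n, ENNReal.ofReal (A n) * ENNReal.ofReal (heatEvolution d μ s (x - latV n)) := by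
    intro x
    rw [hu_ofReal μ ht]
    calc _ ≤ ∫⁻ y, ∑' n, ENNReal.ofReal (A n) * ENNReal.ofReal (heatKernel d s ((x - latV n) - y)) ∂μ := by
          apply lintegral_mono fun y => ?_
          obtain ⟨n, hn⟩ := hCz (x - y)
          refine le_trans ?_ (ENNReal.le_tsum n)
          rw [← ENNReal.ofReal_mul (hA0 n).le]
          apply ENNReal.ofReal_le_ofReal
          rw [sub_right_comm]
          exact hn
      _ = ∑' n, ∫⁻ y, ENNReal.ofReal (A n) * ENNReal.ofReal (heatKernel d s ((x - latV n) - y)) ∂μ := by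
          apply lintegral_tsum
          intro n
          exact (((hk_cont s).comp (by fun_prop)).measurable.ennreal_ofReal.const_mul _).aemeasurable
      _ = _ := by
          congr 1; ext n
          rw [lintegral_const_mul' _ _ ENNReal.ofReal_ne_top, hu_ofReal μ hs]
  have hm : Measurable fun x => ENNReal.ofReal (heatEvolution d μ s x) ^ c :=
    (hu_cont μ hs).measurable.ennreal_ofReal.pow_const c
  calc _ ≤ ∫⁻ x, ∑' n, ENNReal.ofReal (A n) ^ c *
          ENNReal.ofReal (heatEvolution d μ s (x - latV n)) ^ c := by
        apply lintegral_mono fun x => ?_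
        refine (ENNReal.rpow_le_rpow (h1 x) hc.le).trans ((ennreal_tsum_rpow_le _ hc hc1).trans ?_)
        simp_rw [ENNReal.mul_rpow_of_nonneg _ _ hc.le]
        exact le_rfl
    _ = ∑' n, ∫⁻ x, ENNReal.ofReal (A n) ^ c *
          ENNReal.ofReal (heatEvolution d μ s (x - latV n)) ^ c := by
        apply lintegral_tsum
        intro n
        exact ((hm.comp (by fun_prop : Measurable fun x => x - latV n)).const_mul _).aemeasurable
    _ = ∑' n, ENNReal.ofReal (A n) ^ c * ∫⁻ x, ENNReal.ofReal (heatEvolution d μ s x) ^ c := by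
        congr 1; ext n
        rw [lintegral_const_mul' _ _ (ENNReal.rpow_ne_top_of_nonneg hc.le ENNReal.ofReal_ne_top),
          lintegral_sub_right_eq_self (fun x => ENNReal.ofReal (heatEvolution d μ s x) ^ c)]
    _ < ∞ := by
        rw [ENNReal.tsum_mul_right]
        apply ENNReal.mul_lt_top _ h
        have : Summable fun n => A n ^ c := by
          have := (lat_summable (d := d) (b := π / (2 * t) * c) (by positivity)).mul_left (C ^ c)
          refine this.congr fun n => ?_
          rw [hA, Real.mul_rpow hC.le (Real.exp_pos _).le, ← Real.exp_mul]
          congr 2; ring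
        simp_rw [ENNReal.ofReal_rpow_of_pos (hA0 _)]
        exact this.tsum_ofReal_lt_top

end P2

section P3

variable {d : ℕ} (μ : Measure (EuclideanSpace ℝ (Fin d))) [IsFiniteMeasure μ]

lemma simple_integral_comp (ν : Measure (EuclideanSpace ℝ (Fin d))) [IsFiniteMeasure ν]
    (s : SimpleFunc (EuclideanSpace ℝ (Fin d)) (EuclideanSpace ℝ (Fin d)))
    (φ : EuclideanSpace ℝ (Fin d) → ℝ) :
    ∫ y, φ (s y) ∂ν = ∑ v ∈ s.range, ν.real (s ⁻¹' {v}) * φ v := by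
  have h : ∀ y, φ (s y) = ∑ v ∈ s.range, (s ⁻¹' {v}).indicator (fun _ => φ v) y := by
    intro y
    rw [Finset.sum_eq_single (s y)]
    · simp
    · intro v _ hv
      apply Set.indicator_of_notMem
      simpa using fun h => hv h.symm
    · intro h; exact absurd (s.mem_range_self y) h
  simp_rw [h]
  rw [integral_finsetSum]
  · refine Finset.sum_congr rfl fun v _ => ?_
    rw [integral_indicator_const _ (s.measurableSet_fiber v), smul_eq_mul]
  · intro v _
    exact (integrable_const _).indicator (s.measurableSet_fiber v)

/-- unnormalised evolution -/
noncomputable def gU (μ : Measure (EuclideanSpace ℝ (Fin d))) (t : ℝ)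
    (x : EuclideanSpace ℝ (Fin d)) : ℝ := ∫ y, Real.exp (-π * ‖x - y‖ ^ 2 / t) ∂μ

lemma hu_eq_gU (t : ℝ) (x : EuclideanSpace ℝ (Fin d)) :
    heatEvolution d μ t x = t ^ (-(d : ℝ) / 2) * gU μ t x := by
  unfold heatEvolution heatKernel gU
  rw [integral_const_mul]

lemma gU_nonneg (t : ℝ) (x : EuclideanSpace ℝ (Fin d)) : 0 ≤ gU μ t x :=
  integral_nonneg fun _ => (Real.exp_pos _).le

lemma gU_eq {t : ℝ} (ht : 0 < t) (x : EuclideanSpace ℝ (Fin d)) :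
    gU μ t x = (t ^ (-(d : ℝ) / 2))⁻¹ * heatEvolution d μ t x := by
  rw [hu_eq_gU]
  have : t ^ (-(d : ℝ) / 2) ≠ 0 := by positivity
  field_simp

lemma gexp_le_one {t : ℝ} (ht : 0 < t) (z : EuclideanSpace ℝ (Fin d)) :
    Real.exp (-π * ‖z‖ ^ 2 / t) ≤ 1 := by
  apply Real.exp_le_one_iff.2
  apply div_nonpos_of_nonpos_of_nonneg _ ht.le
  have := mul_nonneg Real.pi_pos.le (sq_nonneg ‖z‖)
  linarith

lemma gexp_integrable {t : ℝ} (ht : 0 < t) (x : EuclideanSpace ℝ (Fin d)) :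
    Integrable (fun y => Real.exp (-π * ‖x - y‖ ^ 2 / t)) μ := by
  apply Integrable.of_bound (C := 1)
  · exact (by fun_prop : Continuous fun y => Real.exp (-π * ‖x - y‖ ^ 2 / t)).aestronglyMeasurable
  · refine Eventually.of_forall fun y => ?_
    rw [Real.norm_of_nonneg (Real.exp_pos _).le]
    exact gexp_le_one ht _

lemma gU_approx : ∃ (S : ℕ → Finset (EuclideanSpace ℝ (Fin d)))
    (a : ℕ → EuclideanSpace ℝ (Fin d) → ℝ), (∀ n v, 0 ≤ a n v) ∧
    (∀ n t, 0 < t → ∀ x, kU (S n) (a n) t x ≤ Real.exp (π / t) * gU μ (2 * t) x) ∧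
    (∀ t, 0 < t → ∀ x, Tendsto (fun n => kU (S n) (a n) t x) atTop (𝓝 (gU μ t x))) := by
  have hid : StronglyMeasurable (id : EuclideanSpace ℝ (Fin d) → EuclideanSpace ℝ (Fin d)) :=
    stronglyMeasurable_id
  set s := hid.approx with hs
  have hlim : ∀ y, Tendsto (fun n => s n y) atTop (𝓝 y) := fun y => hid.tendsto_approx y
  set A : ℕ → Set (EuclideanSpace ℝ (Fin d)) := fun n => {y | ‖s n y - y‖ ≤ 1} with hA
  have hAm : ∀ n, MeasurableSet (A n) := fun n =>
    measurableSet_le (((s n).measurable.sub measurable_id).norm) measurable_const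
  have key : ∀ n t x, kU (s n).range (fun v => (μ.restrict (A n)).real (s n ⁻¹' {v})) t x =
      ∫ y, (A n).indicator (fun y => Real.exp (-π * ‖x - s n y‖ ^ 2 / t)) y ∂μ := by
    intro n t x
    rw [integral_indicator (hAm n)]
    rw [simple_integral_comp (μ.restrict (A n)) (s n) (fun v => Real.exp (-π * ‖x - v‖ ^ 2 / t))]
    rfl
  have hmeas : ∀ n t x, Measurable
      ((A n).indicator (fun y => Real.exp (-π * ‖x - s n y‖ ^ 2 / t))) := by
    intro n t x
    apply Measurable.indicator _ (hAm n)
    have : Measurable fun v : EuclideanSpace ℝ (Fin d) => Real.exp (-π * ‖x - v‖ ^ 2 / t) := by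
      fun_prop
    exact this.comp (s n).measurable
  have hb : ∀ n t x, 0 < t → ∀ y,
      ‖(A n).indicator (fun y => Real.exp (-π * ‖x - s n y‖ ^ 2 / t)) y‖ ≤ 1 := by
    intro n t x ht y
    by_cases hy : y ∈ A n
    · rw [Set.indicator_of_mem hy, Real.norm_of_nonneg (Real.exp_pos _).le]
      exact gexp_le_one ht _
    · rw [Set.indicator_of_notMem hy]; simp
  refine ⟨fun n => (s n).range, fun n v => (μ.restrict (A n)).real (s n ⁻¹' {v}),
    fun n v => measureReal_nonneg, ?_, ?_⟩
  · intro n t ht x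
    rw [key, gU, ← integral_const_mul]
    apply integral_mono
    · exact Integrable.of_bound (hmeas n t x).aestronglyMeasurable 1
        (Eventually.of_forall (hb n t x ht))
    · exact (gexp_integrable μ (by positivity) x).const_mul _
    · intro y
      by_cases hy : y ∈ A n
      · rw [Set.indicator_of_mem hy]
        simp only
        rw [← Real.exp_add]
        apply Real.exp_le_exp.2
        have h1 : ‖x - y‖ ≤ ‖x - s n y‖ + ‖s n y - y‖ := norm_sub_le_norm_sub_add_norm_sub _ _ _
        have h2 : ‖s n y - y‖ ≤ 1 := hy
        have h3 : ‖x - y‖ ^ 2 ≤ 2 * ‖x - s n y‖ ^ 2 + 2 := by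
          have := norm_nonneg (x - y)
          have := norm_nonneg (x - s n y)
          nlinarith [sq_nonneg (‖x - s n y‖ - 1)]
        have h4 : π / (2 * t) * ‖x - y‖ ^ 2 ≤ π / (2 * t) * (2 * ‖x - s n y‖ ^ 2 + 2) := by gcongr
        have e1 : π / (2 * t) * (2 * ‖x - s n y‖ ^ 2 + 2) = π / t * ‖x - s n y‖ ^ 2 + π / t := by
          field_simp
        have e2 : -π * ‖x - s n y‖ ^ 2 / t = - (π / t * ‖x - s n y‖ ^ 2) := by ring
        have e3 : -π * ‖x - y‖ ^ 2 / (2 * t) = - (π / (2 * t) * ‖x - y‖ ^ 2) := by ring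
        rw [e2, e3]
        linarith
      · rw [Set.indicator_of_notMem hy]
        positivity
  · intro t ht x
    simp_rw [key]
    unfold gU
    apply tendsto_integral_of_dominated_convergence (fun _ => 1)
    · intro n; exact (hmeas n t x).aestronglyMeasurable
    · exact integrable_const _
    · intro n; exact Eventually.of_forall (hb n t x ht)
    · refine Eventually.of_forall fun y => ?_
      have h1 : Tendsto (fun n => Real.exp (-π * ‖x - s n y‖ ^ 2 / t)) atTop
          (𝓝 (Real.exp (-π * ‖x - y‖ ^ 2 / t))) := by
        have : Continuous fun v : EuclideanSpace ℝ (Fin d) => Real.exp (-π * ‖x - v‖ ^ 2 / t) := by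
          fun_prop
        exact (this.tendsto y).comp (hlim y)
      refine h1.congr' ?_
      have h2 : ∀ᶠ n in atTop, dist (s n y) y < 1 :=
        (Metric.tendsto_nhds.1 (hlim y)) 1 one_pos
      filter_upwards [h2] with n hn
      rw [Set.indicator_of_mem]
      rw [dist_eq_norm] at hn
      exact hn.le

lemma prod_rpow_eq {ι : Type*} [Fintype ι] (f : ι → ℝ) (hf : ∀ i, 0 < f i) (c : ℝ) :
    Real.exp (c * ∑ l, Real.log (f l)) = ∏ l, f l ^ c := by
  rw [Finset.mul_sum, Real.exp_sum]
  refine Finset.prod_congr rfl fun l _ => ?_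
  rw [Real.rpow_def_of_pos (hf l), mul_comm]

lemma gJ_mono {ι : Type*} [Fintype ι] [Nonempty ι] {c : ℝ} (hc : 0 < c)
    (hcm : 1 - 1 / (Fintype.card ι : ℝ) ≤ c) (ε : ι → ℝ) (hε : ∀ l, ε l ^ 2 = 1)
    (g : EuclideanSpace ℝ (Fin d) → ℝ) (hg : Continuous g) (hg0 : ∀ x, 0 ≤ g x)
    (hg1 : ∀ x, g x ≤ 1)
    (hint : ∀ t, 0 < t → Integrable (fun x => heatEvolution d μ t x ^ c)) :
    MonotoneOn (fun t => t ^ (-((d : ℝ) / 2 * ((Fintype.card ι : ℝ) - 1))) *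
      ∫ x : ι → EuclideanSpace ℝ (Fin d), (∏ l, gU μ t (x l) ^ c) * g (∑ l, ε l • x l))
      (Set.Ioi 0) := by
  obtain ⟨S, a, ha, hle, hlim⟩ := gU_approx μ
  have hk0 : ∀ n t x, 0 ≤ kU (S n) (a n) t x := fun n t x =>
    Finset.sum_nonneg fun v _ => mul_nonneg (ha n v) (Real.exp_pos _).le
  have hmono : ∀ n, MonotoneOn (fun t => t ^ (-((d : ℝ) / 2 * ((Fintype.card ι : ℝ) - 1))) *
      ∫ x : ι → EuclideanSpace ℝ (Fin d),
        (∏ l, kU (S n) (a n) t (x l) ^ c) * g (∑ l, ε l • x l)) (Set.Ioi 0) := by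
    intro n
    by_cases h : ∃ v ∈ S n, 0 < a n v
    · have := kJ_mono (S n) (a n) (fun v _ => ha n v) h c hc hcm ε hε g hg hg0 hg1
      simp only [kW] at this
      simp_rw [prod_rpow_eq _ (fun l => kU_pos (S n) (a n) (fun v _ => ha n v) h _ _)] at this
      exact this
    · push Not at h
      have h0 : ∀ t x, kU (S n) (a n) t x = 0 := by
        intro t x
        apply Finset.sum_eq_zero fun v hv => ?_
        rw [le_antisymm (h v hv) (ha n v), zero_mul]
      simp_rw [h0, Real.zero_rpow hc.ne']
      simp [monotoneOn_const]
  have hgi : ∀ t, 0 < t → Integrable (fun x => gU μ t x ^ c) := by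
    intro t ht
    refine ((hint t ht).const_mul ((t ^ (-(d : ℝ) / 2))⁻¹ ^ c)).congr
      (Eventually.of_forall fun x => ?_)
    simp only
    rw [gU_eq μ ht, Real.mul_rpow (by positivity) (hu_nonneg μ ht x)]
  have htend : ∀ t, 0 < t → Tendsto (fun n => t ^ (-((d : ℝ) / 2 * ((Fintype.card ι : ℝ) - 1))) *
      ∫ x : ι → EuclideanSpace ℝ (Fin d),
        (∏ l, kU (S n) (a n) t (x l) ^ c) * g (∑ l, ε l • x l)) atTop
      (𝓝 (t ^ (-((d : ℝ) / 2 * ((Fintype.card ι : ℝ) - 1))) *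
      ∫ x : ι → EuclideanSpace ℝ (Fin d), (∏ l, gU μ t (x l) ^ c) * g (∑ l, ε l • x l))) := by
    intro t ht
    apply Tendsto.const_mul
    apply tendsto_integral_of_dominated_convergence
      (fun x : ι → EuclideanSpace ℝ (Fin d) => ∏ l, (Real.exp (π / t) ^ c * gU μ (2 * t) (x l) ^ c))
    · intro n
      apply Continuous.aestronglyMeasurable
      apply Continuous.mul
      · refine continuous_finsetProd _ fun l _ => ?_
        exact ((kU_cont (S n) (a n) t).comp (continuous_apply l)).rpow_const fun _ => Or.inr hc.le
      · exact hg.comp (by fun_prop)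
    · exact Integrable.fintype_prod
        (f := fun _ : ι => fun x => Real.exp (π / t) ^ c * gU μ (2 * t) x ^ c)
        (fun _ => (hgi (2 * t) (by positivity)).const_mul _)
    · intro n
      refine Eventually.of_forall fun x => ?_
      have hp : 0 ≤ ∏ l, kU (S n) (a n) t (x l) ^ c :=
        Finset.prod_nonneg fun l _ => Real.rpow_nonneg (hk0 n t _) c
      rw [Real.norm_of_nonneg (mul_nonneg hp (hg0 _))]
      calc _ ≤ ∏ l, kU (S n) (a n) t (x l) ^ c := mul_le_of_le_one_right hp (hg1 _)
        _ ≤ _ := by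
          apply Finset.prod_le_prod
          · exact fun l _ => Real.rpow_nonneg (hk0 n t _) c
          · intro l _
            rw [← Real.mul_rpow (Real.exp_pos _).le (gU_nonneg μ _ _)]
            exact Real.rpow_le_rpow (hk0 n t _) (hle n t ht _) hc.le
    · refine Eventually.of_forall fun x => ?_
      apply Tendsto.mul_const
      apply tendsto_finsetProd
      intro l _
      exact (hlim t ht (x l)).rpow_const (Or.inr hc.le)
  intro s hs t ht hst
  exact le_of_tendsto_of_tendsto' (htend s hs) (htend t ht) fun n => hmono n hs ht hst

lemma hJ_mono {ι : Type*} [Fintype ι] [Nonempty ι] {c : ℝ} (hc : 0 < c)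
    (hcm : 1 - 1 / (Fintype.card ι : ℝ) ≤ c) (ε : ι → ℝ) (hε : ∀ l, ε l ^ 2 = 1)
    (g : EuclideanSpace ℝ (Fin d) → ℝ) (hg : Continuous g) (hg0 : ∀ x, 0 ≤ g x)
    (hg1 : ∀ x, g x ≤ 1)
    (hint : ∀ t, 0 < t → Integrable (fun x => heatEvolution d μ t x ^ c)) :
    MonotoneOn (fun t => t ^ ((d : ℝ) / 2 * ((Fintype.card ι : ℝ) * c - ((Fintype.card ι : ℝ) - 1))) *
      ∫ x : ι → EuclideanSpace ℝ (Fin d),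
        (∏ l, heatEvolution d μ t (x l) ^ c) * g (∑ l, ε l • x l))
      (Set.Ioi 0) := by
  refine (gJ_mono μ hc hcm ε hε g hg hg0 hg1 hint).congr ?_
  intro t ht
  have ht : 0 < t := ht
  simp only
  have h1 : ∀ x : ι → EuclideanSpace ℝ (Fin d), ∏ l, heatEvolution d μ t (x l) ^ c =
      t ^ (-((d : ℝ) / 2) * c * Fintype.card ι) * ∏ l, gU μ t (x l) ^ c := by
    intro x
    have : ∀ l, heatEvolution d μ t (x l) ^ c = t ^ (-((d : ℝ) / 2) * c) * gU μ t (x l) ^ c := by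
      intro l
      rw [hu_eq_gU, Real.mul_rpow (by positivity) (gU_nonneg μ _ _), ← Real.rpow_mul ht.le]
      congr 2; ring
    simp_rw [this]
    rw [Finset.prod_mul_distrib, Finset.prod_const, Finset.card_univ, ← Real.rpow_natCast,
      ← Real.rpow_mul ht.le]
  simp_rw [h1, mul_assoc (t ^ (-((d : ℝ) / 2) * c * Fintype.card ι))]
  rw [integral_const_mul, ← mul_assoc, ← Real.rpow_add ht]
  congr 2; ring

end P3

section P1

variable {d : ℕ}

lemma gauss_fourier {δ : ℝ} (hδ : 0 < δ) (z : (EuclideanSpace ℝ (Fin d))) :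
    ∫ ξ : (EuclideanSpace ℝ (Fin d)), Complex.exp ((-2 * π * inner ℝ ξ z : ℝ) * Complex.I) *
        ((Real.exp (-(π * δ) * ‖ξ‖ ^ 2) : ℝ) : ℂ) =
      (((δ⁻¹) ^ ((d : ℝ) / 2) * Real.exp (-π * ‖z‖ ^ 2 / δ) : ℝ) : ℂ) := by
  have hb : 0 < ((π * δ : ℝ) : ℂ).re := by simp; positivity
  have h := fourier_gaussian_innerProductSpace (V := (EuclideanSpace ℝ (Fin d))) hb z
  rw [Real.fourier_eq'] at h
  simp only [smul_eq_mul] at h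
  convert! h using 1
  · congr 1; ext ξ
    push_cast; ring_nf
  · have e1 : (π : ℂ) / ((π * δ : ℝ) : ℂ) = ((δ⁻¹ : ℝ) : ℂ) := by
      push_cast; field_simp
    rw [e1, Complex.ofReal_mul, Complex.ofReal_cpow (by positivity)]
    congr 1
    · simp
    · have e2 : -π * ‖z‖ ^ 2 / δ = -π ^ 2 * ‖z‖ ^ 2 / (π * δ) := by field_simp
      rw [e2]; push_cast; ring_nf

lemma fourier_smul_eq (f : (EuclideanSpace ℝ (Fin d)) → ℝ) (e : ℝ) (ξ : (EuclideanSpace ℝ (Fin d))) :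
    𝓕 (fun x => (f x : ℂ)) (e • ξ) =
      ∫ x : (EuclideanSpace ℝ (Fin d)), Complex.exp ((-2 * π * inner ℝ ξ (e • x) : ℝ) * Complex.I) * (f x : ℂ) := by
  rw [Real.fourier_eq']
  congr 1; ext x
  rw [smul_eq_mul, real_inner_smul_right, real_inner_smul_right, real_inner_comm]

lemma fourier_prod_eq {ι : Type*} [Fintype ι] (ε : ι → ℝ) (f : (EuclideanSpace ℝ (Fin d)) → ℝ) (ξ : (EuclideanSpace ℝ (Fin d))) :
    ∏ l, 𝓕 (fun x => (f x : ℂ)) (ε l • ξ) =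
      ∫ x : ι → (EuclideanSpace ℝ (Fin d)), Complex.exp ((-2 * π * inner ℝ ξ (∑ l, ε l • x l) : ℝ) * Complex.I) *
        ((∏ l, f (x l) : ℝ) : ℂ) := by
  simp_rw [fourier_smul_eq]
  rw [← integral_fintype_prod_volume_eq_prod (fun l (x : (EuclideanSpace ℝ (Fin d))) =>
    Complex.exp ((-2 * π * inner ℝ ξ (ε l • x) : ℝ) * Complex.I) * (f x : ℂ))]
  congr 1; ext x
  rw [Finset.prod_mul_distrib, ← Complex.exp_sum]
  congr 2
  · rw [← Finset.sum_mul, inner_sum, Finset.mul_sum]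
    push_cast; rfl
  · push_cast; rfl

lemma fourier_gauss_eq {ι : Type*} [Fintype ι] (ε : ι → ℝ) (f : (EuclideanSpace ℝ (Fin d)) → ℝ)
    (hf : Continuous f) (hfi : Integrable f) {δ : ℝ} (hδ : 0 < δ) :
    ∫ ξ : (EuclideanSpace ℝ (Fin d)), (∏ l, 𝓕 (fun x => (f x : ℂ)) (ε l • ξ)) *
        ((Real.exp (-(π * δ) * ‖ξ‖ ^ 2) : ℝ) : ℂ) =
      (((δ⁻¹) ^ ((d : ℝ) / 2) * ∫ x : ι → (EuclideanSpace ℝ (Fin d)),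
        (∏ l, f (x l)) * Real.exp (-π * ‖∑ l, ε l • x l‖ ^ 2 / δ) : ℝ) : ℂ) := by
  simp_rw [fourier_prod_eq, ← integral_mul_const]
  have hP : Integrable (fun x : ι → (EuclideanSpace ℝ (Fin d)) => ∏ l, f (x l)) :=
    Integrable.fintype_prod (f := fun _ : ι => f) (fun _ => hfi)
  rw [integral_integral_swap]
  · rw [Complex.ofReal_mul, ← integral_complex_ofReal, ← integral_const_mul]
    congr 1; ext x
    have := gauss_fourier hδ (∑ l, ε l • x l)
    calc _ = ∫ ξ : (EuclideanSpace ℝ (Fin d)), ((∏ l, f (x l) : ℝ) : ℂ) *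
          (Complex.exp ((-2 * π * inner ℝ ξ (∑ l, ε l • x l) : ℝ) * Complex.I) *
          ((Real.exp (-(π * δ) * ‖ξ‖ ^ 2) : ℝ) : ℂ)) := by
          congr 1; ext ξ; ring
      _ = _ := by
          rw [integral_const_mul, this]; push_cast; ring
  · have h1 : Integrable (fun q : (EuclideanSpace ℝ (Fin d)) × (ι → (EuclideanSpace ℝ (Fin d))) =>
        Real.exp (-(π * δ) * ‖q.1‖ ^ 2) * ∏ l, f (q.2 l)) (volume.prod volume) :=
      (integrable_gaussE (d := d) (π * δ) (by positivity)).mul_prod hP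
    refine h1.mono ?_ (Eventually.of_forall fun q => ?_)
    · apply Continuous.aestronglyMeasurable
      simp only [Function.uncurry_def]
      fun_prop
    · simp only [Function.uncurry_def, norm_mul, Complex.norm_exp_ofReal_mul_I, one_mul,
        Complex.norm_real]
      rw [mul_comm]

lemma fourier_neg_conj (f : (EuclideanSpace ℝ (Fin d)) → ℝ) (ξ : (EuclideanSpace ℝ (Fin d))) :
    𝓕 (fun x => (f x : ℂ)) (-ξ) = (starRingEnd ℂ) (𝓕 (fun x => (f x : ℂ)) ξ) := by
  rw [Real.fourier_eq', Real.fourier_eq', ← integral_conj]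
  congr 1; ext x
  simp only [smul_eq_mul, map_mul, ← Complex.exp_conj, Complex.conj_ofReal, Complex.conj_I,
    inner_neg_right]
  congr 2; push_cast; ring

lemma fourier_prod_sum (f : (EuclideanSpace ℝ (Fin d)) → ℝ) (k : ℕ) (ξ : (EuclideanSpace ℝ (Fin d))) :
    ∏ l : Fin k ⊕ Fin k, 𝓕 (fun x => (f x : ℂ)) ((Sum.elim (fun _ => (1:ℝ)) (fun _ => -1) l) • ξ) =
      ((‖𝓕 (fun x => (f x : ℂ)) ξ‖ ^ (2 * k) : ℝ) : ℂ) := by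
  rw [Fintype.prod_sum_type]
  simp only [Sum.elim_inl, Sum.elim_inr, one_smul, neg_smul, fourier_neg_conj, Finset.prod_const,
    Finset.card_univ, Fintype.card_fin]
  rw [← mul_pow, Complex.mul_conj', pow_mul]
  push_cast; rfl

lemma fourier_prod_two (f : (EuclideanSpace ℝ (Fin d)) → ℝ) (ξ : (EuclideanSpace ℝ (Fin d))) :
    ∏ l : Fin 2, 𝓕 (fun x => (f x : ℂ)) ((![(1:ℝ), -1] l) • ξ) =
      ((‖𝓕 (fun x => (f x : ℂ)) ξ‖ ^ 2 : ℝ) : ℂ) := by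
  rw [Fin.prod_univ_two]
  simp only [Matrix.cons_val_zero, Matrix.cons_val_one, one_smul, neg_smul, fourier_neg_conj]
  rw [Complex.mul_conj']
  push_cast; rfl

lemma fourier_cont (f : (EuclideanSpace ℝ (Fin d)) → ℝ) (hfi : Integrable f) : Continuous (𝓕 (fun x => (f x : ℂ))) := by
  have : Continuous fun p : (EuclideanSpace ℝ (Fin d)) × (EuclideanSpace ℝ (Fin d)) => (innerₗ (EuclideanSpace ℝ (Fin d))) p.1 p.2 := continuous_inner
  exact VectorFourier.fourierIntegral_continuous Real.continuous_fourierChar this hfi.ofReal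

lemma fourier_le (f : (EuclideanSpace ℝ (Fin d)) → ℝ) (ξ : (EuclideanSpace ℝ (Fin d))) : ‖𝓕 (fun x => (f x : ℂ)) ξ‖ ≤ ∫ x, ‖f x‖ := by
  have := VectorFourier.norm_fourierIntegral_le_integral_norm Real.fourierChar volume (innerₗ (EuclideanSpace ℝ (Fin d)))
    (fun x => (f x : ℂ)) ξ
  simp only [Complex.norm_real] at this
  exact this

lemma fourier_gauss_lint {ι : Type*} [Fintype ι] (ε : ι → ℝ) (m : ℕ) (f : (EuclideanSpace ℝ (Fin d)) → ℝ)
    (hf : Continuous f) (hfi : Integrable f)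
    (hm : ∀ ξ, ∏ l, 𝓕 (fun x => (f x : ℂ)) (ε l • ξ) = ((‖𝓕 (fun x => (f x : ℂ)) ξ‖ ^ m : ℝ) : ℂ))
    {δ : ℝ} (hδ : 0 < δ) :
    ∫⁻ ξ : (EuclideanSpace ℝ (Fin d)), ENNReal.ofReal (‖𝓕 (fun x => (f x : ℂ)) ξ‖ ^ m * Real.exp (-(π * δ) * ‖ξ‖ ^ 2)) =
      ENNReal.ofReal ((δ⁻¹) ^ ((d : ℝ) / 2) * ∫ x : ι → (EuclideanSpace ℝ (Fin d)),
        (∏ l, f (x l)) * Real.exp (-π * ‖∑ l, ε l • x l‖ ^ 2 / δ)) := by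
  have h := fourier_gauss_eq ε f hf hfi hδ
  simp_rw [hm, ← Complex.ofReal_mul] at h
  rw [integral_complex_ofReal, Complex.ofReal_inj] at h
  rw [← h]
  symm
  apply ofReal_integral_eq_lintegral_ofReal
  · refine ((integrable_gaussE (d := d) (π * δ) (by positivity)).const_mul
      ((∫ x, ‖f x‖) ^ m)).mono' ?_ (Eventually.of_forall fun ξ => ?_)
    · apply Continuous.aestronglyMeasurable
      have := fourier_cont f hfi
      fun_prop
    · rw [Real.norm_of_nonneg (by positivity)]
      gcongr
      exact fourier_le f ξ
  · exact Eventually.of_forall fun ξ => by simp only [Pi.zero_apply]; positivity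

lemma lint_tendsto (h : (EuclideanSpace ℝ (Fin d)) → ℝ) (hc : Continuous h) (h0 : ∀ ξ, 0 ≤ h ξ) :
    Tendsto (fun n : ℕ => ∫⁻ ξ : (EuclideanSpace ℝ (Fin d)), ENNReal.ofReal (h ξ *
      Real.exp (-(π * (1 / ((n : ℝ) + 1))) * ‖ξ‖ ^ 2))) atTop
      (𝓝 (∫⁻ ξ : (EuclideanSpace ℝ (Fin d)), ENNReal.ofReal (h ξ))) := by
  apply lintegral_tendsto_of_tendsto_of_monotone
  · intro n
    apply Measurable.aemeasurable
    apply Measurable.ennreal_ofReal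
    apply Continuous.measurable
    fun_prop
  · refine Eventually.of_forall fun ξ n m hnm => ?_
    apply ENNReal.ofReal_le_ofReal
    apply mul_le_mul_of_nonneg_left _ (h0 ξ)
    apply Real.exp_le_exp.2
    apply mul_le_mul_of_nonneg_right _ (sq_nonneg _)
    apply neg_le_neg
    apply mul_le_mul_of_nonneg_left _ Real.pi_pos.le
    exact Nat.one_div_le_one_div hnm
  · refine Eventually.of_forall fun ξ => ?_
    apply ENNReal.tendsto_ofReal
    have h1 : Tendsto (fun n : ℕ => 1 / ((n : ℝ) + 1)) atTop (𝓝 0) :=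
      tendsto_one_div_add_atTop_nhds_zero_nat
    have h2 : Continuous fun r : ℝ => h ξ * Real.exp (-(π * r) * ‖ξ‖ ^ 2) := by fun_prop
    have h3 := (h2.tendsto 0).comp h1
    simpa [Function.comp_def] using h3

lemma two_bound (f : (EuclideanSpace ℝ (Fin d)) → ℝ) (hf : Continuous f) (hfi : Integrable f) (hf0 : ∀ x, 0 ≤ f x)
    {M : ℝ} (hM : ∀ x, f x ≤ M) {δ : ℝ} (hδ : 0 < δ) :
    (δ⁻¹) ^ ((d : ℝ) / 2) * ∫ x : Fin 2 → (EuclideanSpace ℝ (Fin d)),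
        (∏ l, f (x l)) * Real.exp (-π * ‖∑ l, (![(1:ℝ), -1] l) • x l‖ ^ 2 / δ) ≤ M * ∫ x, f x := by
  have hM0 : 0 ≤ M := (hf0 0).trans (hM 0)
  have e1 : ∫ x : Fin 2 → (EuclideanSpace ℝ (Fin d)),
        (∏ l, f (x l)) * Real.exp (-π * ‖∑ l, (![(1:ℝ), -1] l) • x l‖ ^ 2 / δ) =
      ∫ q : (EuclideanSpace ℝ (Fin d)) × (EuclideanSpace ℝ (Fin d)), f q.1 * f q.2 * Real.exp (-π * ‖q.1 - q.2‖ ^ 2 / δ) := by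
    rw [← (volume_preserving_finTwoArrow (EuclideanSpace ℝ (Fin d))).integral_comp
      (MeasurableEquiv.finTwoArrow (α := (EuclideanSpace ℝ (Fin d)))).measurableEmbedding]
    congr 1; ext x
    simp [Fin.prod_univ_two, Fin.sum_univ_two, MeasurableEquiv.finTwoArrow, sub_eq_add_neg]
  have hG : ∫ y : (EuclideanSpace ℝ (Fin d)), Real.exp (-(π / δ) * ‖y‖ ^ 2) = δ ^ ((d : ℝ) / 2) := by
    rw [GaussianFourier.integral_rexp_neg_mul_sq_norm (by positivity)]
    congr 1
    · field_simp
    · simp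
  have hGi := integrable_gaussE (d := d) (π / δ) (by positivity)
  have hb : ∀ z : (EuclideanSpace ℝ (Fin d)), Real.exp (-π * ‖z‖ ^ 2 / δ) = Real.exp (-(π / δ) * ‖z‖ ^ 2) := by
    intro z; congr 1; ring
  have hint : Integrable (fun q : (EuclideanSpace ℝ (Fin d)) × (EuclideanSpace ℝ (Fin d)) => f q.1 * f q.2 * Real.exp (-π * ‖q.1 - q.2‖ ^ 2 / δ))
      (volume.prod volume) := by
    refine (hfi.mul_prod hfi).mono (Continuous.aestronglyMeasurable (by fun_prop))
      (Eventually.of_forall fun q => ?_)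
    rw [norm_mul, Real.norm_of_nonneg (Real.exp_pos _).le]
    exact mul_le_of_le_one_right (norm_nonneg _) (gexp_le_one hδ _)
  have e2 : ∫ q : (EuclideanSpace ℝ (Fin d)) × (EuclideanSpace ℝ (Fin d)), f q.1 * f q.2 * Real.exp (-π * ‖q.1 - q.2‖ ^ 2 / δ) ≤
      (M * ∫ x, f x) * δ ^ ((d : ℝ) / 2) := by
    rw [Measure.volume_eq_prod, integral_prod _ hint, mul_right_comm, ← integral_const_mul]
    apply integral_mono hint.integral_prod_left (hfi.const_mul _)
    intro x
    simp only
    calc _ ≤ ∫ y : (EuclideanSpace ℝ (Fin d)), (f x * M) * Real.exp (-(π / δ) * ‖x - y‖ ^ 2) := by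
          apply integral_mono_of_nonneg
          · exact Eventually.of_forall fun y => by
              have := hf0 x; have := hf0 y
              simp only [Pi.zero_apply]; positivity
          · exact (hGi.comp_sub_left x).const_mul _
          · refine Eventually.of_forall fun y => ?_
            simp only [hb]
            have := hf0 x
            have := hM y
            gcongr
      _ = M * δ ^ ((d : ℝ) / 2) * f x := by
          rw [integral_const_mul, integral_sub_left_eq_self
            (fun y : (EuclideanSpace ℝ (Fin d)) => Real.exp (-(π / δ) * ‖y‖ ^ 2)), hG]
          ring
  rw [e1]
  calc _ ≤ (δ⁻¹) ^ ((d : ℝ) / 2) * ((M * ∫ x, f x) * δ ^ ((d : ℝ) / 2)) := by gcongr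
    _ = _ := by
      rw [Real.inv_rpow hδ.le]
      have : δ ^ ((d : ℝ) / 2) ≠ 0 := by positivity
      field_simp

lemma fourier_two_fin (f : (EuclideanSpace ℝ (Fin d)) → ℝ) (hf : Continuous f) (hfi : Integrable f) (hf0 : ∀ x, 0 ≤ f x)
    {M : ℝ} (hM : ∀ x, f x ≤ M) :
    ∫⁻ ξ : (EuclideanSpace ℝ (Fin d)), ENNReal.ofReal (‖𝓕 (fun x => (f x : ℂ)) ξ‖ ^ 2) ≤ ENNReal.ofReal (M * ∫ x, f x) := by
  have hc := fourier_cont f hfi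
  refine le_of_tendsto' (lint_tendsto (fun ξ => ‖𝓕 (fun x => (f x : ℂ)) ξ‖ ^ 2) (by fun_prop)
    (fun ξ => by positivity)) fun n => ?_
  rw [fourier_gauss_lint ![(1:ℝ), -1] 2 f hf hfi (fourier_prod_two f) (by positivity)]
  exact ENNReal.ofReal_le_ofReal (two_bound f hf hfi hf0 hM (by positivity))

lemma fourier_even_fin (f : (EuclideanSpace ℝ (Fin d)) → ℝ) (hf : Continuous f) (hfi : Integrable f) (hf0 : ∀ x, 0 ≤ f x)
    {M : ℝ} (hM : ∀ x, f x ≤ M) {k : ℕ} (hk : 0 < k) :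
    ∫⁻ ξ : (EuclideanSpace ℝ (Fin d)), ENNReal.ofReal (‖𝓕 (fun x => (f x : ℂ)) ξ‖ ^ (2 * k)) < ∞ := by
  obtain ⟨j, rfl⟩ : ∃ j, k = j + 1 := ⟨k - 1, by omega⟩
  calc _ ≤ ∫⁻ ξ : (EuclideanSpace ℝ (Fin d)), ENNReal.ofReal ((∫ x, ‖f x‖) ^ (2 * j)) *
          ENNReal.ofReal (‖𝓕 (fun x => (f x : ℂ)) ξ‖ ^ 2) := by
        apply lintegral_mono fun ξ => ?_
        rw [← ENNReal.ofReal_mul (by positivity)]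
        apply ENNReal.ofReal_le_ofReal
        rw [mul_add, pow_add]
        gcongr
        exact fourier_le f ξ
    _ = ENNReal.ofReal ((∫ x, ‖f x‖) ^ (2 * j)) *
          ∫⁻ ξ : (EuclideanSpace ℝ (Fin d)), ENNReal.ofReal (‖𝓕 (fun x => (f x : ℂ)) ξ‖ ^ 2) :=
        lintegral_const_mul' _ _ ENNReal.ofReal_ne_top
    _ < ∞ := ENNReal.mul_lt_top ENNReal.ofReal_lt_top
        ((fourier_two_fin f hf hfi hf0 hM).trans_lt ENNReal.ofReal_lt_top)

end P1

section Fin15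

variable {d : ℕ} (μ : Measure (EuclideanSpace ℝ (Fin d))) [IsFiniteMeasure μ]

/-- the `2k`-th moment of the Fourier transform -/
noncomputable def fI (μ : Measure (EuclideanSpace ℝ (Fin d))) (c : ℝ) (k : ℕ) (t : ℝ) : ℝ≥0∞ :=
  ∫⁻ ξ : EuclideanSpace ℝ (Fin d), ENNReal.ofReal
    (‖𝓕 (fun x => ((heatEvolution d μ t x ^ c : ℝ) : ℂ)) ξ‖ ^ (2 * k))

lemma fI_mono {k : ℕ} (hk : 0 < k) {c : ℝ} (hc : 0 < c) (hck : 1 - c ≤ 1 / (2 * k : ℝ))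
    (hint : ∀ t, 0 < t → Integrable (fun x => heatEvolution d μ t x ^ c))
    {s t : ℝ} (hs : 0 < s) (ht : 0 < t) (hst : s ≤ t) :
    ENNReal.ofReal (s ^ ((d : ℝ) / 2 * (2 * k * c - (2 * k - 1)))) * fI μ c k s ≤
      ENNReal.ofReal (t ^ ((d : ℝ) / 2 * (2 * k * c - (2 * k - 1)))) * fI μ c k t := by
  have hlim : ∀ r, 0 < r → Tendsto (fun n : ℕ =>
      ENNReal.ofReal (r ^ ((d : ℝ) / 2 * (2 * k * c - (2 * k - 1)))) *
        ∫⁻ ξ : EuclideanSpace ℝ (Fin d), ENNReal.ofReal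
          (‖𝓕 (fun x => ((heatEvolution d μ r x ^ c : ℝ) : ℂ)) ξ‖ ^ (2 * k) *
          Real.exp (-(π * (1 / ((n : ℝ) + 1))) * ‖ξ‖ ^ 2))) atTop
      (𝓝 (ENNReal.ofReal (r ^ ((d : ℝ) / 2 * (2 * k * c - (2 * k - 1)))) * fI μ c k r)) := by
    intro r hr
    have hcont := fourier_cont (fun x => heatEvolution d μ r x ^ c) (hint r hr)
    exact ENNReal.Tendsto.const_mul (lint_tendsto _ (by fun_prop) (fun ξ => by positivity))
      (Or.inr ENNReal.ofReal_ne_top)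
  refine le_of_tendsto_of_tendsto' (hlim s hs) (hlim t ht) fun n => ?_
  have hδ : (0 : ℝ) < 1 / ((n : ℝ) + 1) := by positivity
  generalize (1 / ((n : ℝ) + 1)) = δ at hδ
  rw [fourier_gauss_lint (Sum.elim (fun _ : Fin k => (1:ℝ)) (fun _ : Fin k => -1)) (2 * k) _
      (hu_rpow_cont μ hs hc) (hint s hs) (fourier_prod_sum _ k) hδ,
    fourier_gauss_lint (Sum.elim (fun _ : Fin k => (1:ℝ)) (fun _ : Fin k => -1)) (2 * k) _
      (hu_rpow_cont μ ht hc) (hint t ht) (fourier_prod_sum _ k) hδ,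
    ← ENNReal.ofReal_mul (by positivity), ← ENNReal.ofReal_mul (by positivity)]
  apply ENNReal.ofReal_le_ofReal
  have : Nonempty (Fin k ⊕ Fin k) := ⟨Sum.inl ⟨0, hk⟩⟩
  have hcard : (Fintype.card (Fin k ⊕ Fin k) : ℝ) = 2 * k := by
    simp; ring
  have := hJ_mono μ (ι := Fin k ⊕ Fin k) hc (by rw [hcard]; linarith)
    (Sum.elim (fun _ : Fin k => (1:ℝ)) (fun _ : Fin k => -1)) (by rintro (l | l) <;> simp)
    (fun z => Real.exp (-π * ‖z‖ ^ 2 / δ)) (by fun_prop) (fun z => (Real.exp_pos _).le)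
    (fun z => gexp_le_one hδ z) hint hs ht hst
  simp only [hcard] at this
  have hD : 0 ≤ (δ⁻¹) ^ ((d : ℝ) / 2) := by positivity
  have h2 := mul_le_mul_of_nonneg_left this hD
  calc _ = _ := mul_left_comm _ _ _
    _ ≤ _ := h2
    _ = _ := mul_left_comm _ _ _

lemma Q_eq {k : ℕ} (hk : 0 < k) (p : ℝ) {t : ℝ} (ht : 0 < t) :
    Q d μ p (2 * k) t = ((ENNReal.ofReal (t ^ ((d : ℝ) / 2 * (2 * k * (1 / p) - (2 * k - 1)))) *
      fI μ (1 / p) k t) ^ (1 / (2 * k : ℝ))).toReal := by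
  have hk' : (0:ℝ) < 2 * k := by positivity
  have h0 : ENNReal.ofReal (2 * k : ℝ) ≠ 0 := by simpa using hk.ne'
  unfold Q
  rw [eLpNorm_eq_lintegral_rpow_enorm_toReal h0 ENNReal.ofReal_ne_top,
    ENNReal.toReal_ofReal hk'.le, ENNReal.mul_rpow_of_nonneg _ _ (by positivity), ENNReal.toReal_mul,
    ENNReal.ofReal_rpow_of_pos (by positivity), ENNReal.toReal_ofReal (by positivity),
    ← Real.rpow_mul ht.le]
  congr 1
  · congr 1; field_simp; ring
  · congr 2
    unfold fI
    congr 1; ext ξ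
    rw [ENNReal.ofReal_pow (norm_nonneg _), ofReal_norm, ← ENNReal.rpow_natCast]
    push_cast; rfl

end Fin15


/-- if `q = 2k` is an even integer, `1 ≤ p` and `q ≤ p'`, then for every positive
finite Borel measure `μ` on `ℝ^d` the quantity `Q_{p,q}(t)` is nondecreasing for `t > 0`. -/
theorem statement15 (d k : ℕ) (hd : 0 < d) (hk : 0 < k) (p : ℝ) (hp : 1 ≤ p)
    (hqp : 1 - 1 / p ≤ 1 / (2 * k : ℝ))
    (μ : Measure (EuclideanSpace ℝ (Fin d))) [IsFiniteMeasure μ] (hμ : μ ≠ 0) :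
    MonotoneOn (Q d μ p (2 * k)) (Set.Ioi 0) := by
  intro s hs t ht hst
  have hs : 0 < s := hs
  have ht : 0 < t := ht
  have hc : 0 < 1 / p := by positivity
  have hc1 : 1 / p ≤ 1 := by rw [div_le_one (by linarith)]; exact hp
  by_cases h : Integrable (fun x => heatEvolution d μ s x ^ (1 / p))
  · have hint : ∀ r, 0 < r → Integrable (fun x => heatEvolution d μ r x ^ (1 / p)) :=
      fun r hr => hu_integrable_transfer μ hs hr hc hc1 h
    rw [Q_eq μ hk p hs, Q_eq μ hk p ht]
    have hfin : fI μ (1 / p) k t < ∞ :=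
      fourier_even_fin (fun x => heatEvolution d μ t x ^ (1 / p)) (hu_rpow_cont μ ht hc) (hint t ht)
        (fun x => Real.rpow_nonneg (hu_nonneg μ ht x) _)
        (M := (t ^ (-(d : ℝ) / 2) * μ.real Set.univ) ^ (1 / p))
        (fun x => Real.rpow_le_rpow (hu_nonneg μ ht x) (hu_le μ ht x) hc.le) hk
    apply ENNReal.toReal_mono
    · exact ENNReal.rpow_ne_top_of_nonneg (by positivity)
        (ENNReal.mul_ne_top ENNReal.ofReal_ne_top hfin.ne)
    · exact ENNReal.rpow_le_rpow (fI_mono μ hk hc hqp hint hs ht hst) (by positivity)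
  · have h0 : (𝓕 fun x => ((heatEvolution d μ s x ^ (1 / p) : ℝ) : ℂ)) = 0 := by
      ext ξ
      rw [Real.fourier_eq]
      apply integral_undef
      rw [Real.fourierIntegral_convergent_iff]
      intro h'
      exact h (by simpa using h'.re)
    have : Q d μ p (2 * k) s = 0 := by
      unfold Q; rw [h0]; simp
    rw [this]
    unfold Q
    exact mul_nonneg (Real.rpow_nonneg ht.le _) ENNReal.toReal_nonneg
end

section
/- Let d ∈ ℕ and p ∈ (1,∞) with dual exponent p'. Then ‖ (H_1^{1/p})^∧ ‖_{L^{p'}(ℝ^d)} = (p^{1/p} / p'^{1/p'})^{d/2}, where H_1(x) = e^{−π|x|²} is the heat kernel at time 1. -/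
open MeasureTheory Real
open scoped FourierTransform ENNReal

lemma aux_fourier (d : ℕ) (p : ℝ) (hp : 0 < p) :
    (𝓕 fun x : EuclideanSpace ℝ (Fin d) => ((Real.exp (-π * ‖x‖ ^ 2) ^ (1 / p) : ℝ) : ℂ)) =
    fun w => ((p ^ ((d : ℝ) / 2) * Real.exp (-(π * p) * ‖w‖ ^ 2) : ℝ) : ℂ) := by
  have hb : 0 < (((π / p : ℝ) : ℂ)).re := by
    rw [Complex.ofReal_re]; positivity
  have h1 : (fun x : EuclideanSpace ℝ (Fin d) => ((Real.exp (-π * ‖x‖ ^ 2) ^ (1 / p) : ℝ) : ℂ)) =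
      fun x => Complex.exp (-((π / p : ℝ) : ℂ) * (‖x‖ : ℂ) ^ 2) := by
    funext x
    rw [← Real.exp_mul, Complex.ofReal_exp]
    congr 1
    push_cast
    ring
  rw [h1]
  funext w
  rw [fourier_gaussian_innerProductSpace hb w]
  have hpi : (π : ℂ) ≠ 0 := by exact_mod_cast Real.pi_ne_zero
  have hpc : (p : ℂ) ≠ 0 := by exact_mod_cast hp.ne'
  rw [Complex.ofReal_mul, Complex.ofReal_exp, Complex.ofReal_cpow hp.le]
  congr 1
  · congr 1
    · push_cast
      field_simp
    · simp
  · congr 1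
    push_cast
    field_simp

/-- for `p ∈ (1,∞)` and `H₁(x) = e^{-π|x|²}` the heat kernel at time 1 on `ℝ^d`,
one has `‖(H₁^{1/p})^∧‖_{L^{p'}(ℝ^d)} = (p^{1/p}/p'^{1/p'})^{d/2}` where `1/p + 1/p' = 1`. -/
theorem statement17 (d : ℕ) (hd : 0 < d) (p : ℝ) (hp : 1 < p) :
    (eLpNorm
        (𝓕 fun x : EuclideanSpace ℝ (Fin d) => ((Real.exp (-π * ‖x‖ ^ 2) ^ (1 / p) : ℝ) : ℂ))
        (ENNReal.ofReal (p / (p - 1))) volume).toReal =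
      (p ^ (1 / p) / (p / (p - 1)) ^ (1 - 1 / p)) ^ ((d : ℝ) / 2) := by
  have hp0 : 0 < p := by linarith
  have hp1 : 0 < p - 1 := by linarith
  rw [aux_fourier d p hp0]
  have hq : 0 < p / (p - 1) := by positivity
  have hqi : 1 / p = 1 - 1 / (p / (p - 1)) := by field_simp; ring
  generalize p / (p - 1) = q at *
  rw [hqi, eLpNorm_eq_lintegral_rpow_enorm_toReal (by simpa using hq) ENNReal.ofReal_ne_top,
    ENNReal.toReal_ofReal hq.le, ← ENNReal.toReal_rpow, ← integral_toReal]
  rotate_left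
  · apply Continuous.aemeasurable
    fun_prop
  · filter_upwards with x
    exact ENNReal.rpow_lt_top_of_nonneg hq.le enorm_ne_top
  have h2 : ∀ w : EuclideanSpace ℝ (Fin d),
      (‖((p ^ ((d : ℝ) / 2) * Real.exp (-(π * p) * ‖w‖ ^ 2) : ℝ) : ℂ)‖ₑ ^ q).toReal =
      p ^ ((d : ℝ) / 2 * q) * Real.exp (-(π * p * q) * ‖w‖ ^ 2) := by
    intro w
    rw [← ENNReal.toReal_rpow, toReal_enorm, Complex.norm_real, Real.norm_of_nonneg (by positivity),
      Real.mul_rpow (by positivity) (by positivity), ← Real.rpow_mul hp0.le, ← Real.exp_mul]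
    congr 2
    ring
  simp_rw [h2]
  rw [integral_const_mul, GaussianFourier.integral_rexp_neg_mul_sq_norm (by positivity)]
  have h3 : π / (π * p * q) = (p * q)⁻¹ := by
    have := Real.pi_pos
    field_simp
  rw [h3, finrank_euclideanSpace_fin]
  apply Real.log_injOn_pos
  · rw [Set.mem_Ioi]
    positivity
  · rw [Set.mem_Ioi]
    positivity
  rw [Real.log_rpow (by positivity), Real.log_mul (by positivity) (by positivity),
    Real.log_rpow hp0, Real.log_rpow (by positivity), Real.log_inv,
    Real.log_mul (by positivity) (by positivity), Real.log_rpow (by positivity),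
    Real.log_div (by positivity) (by positivity), Real.log_rpow hp0, Real.log_rpow hq]
  field_simp
  ring
end

section
/- Let d, k ∈ ℕ, set n = (2k−1)d, and for j = 1,…,2k−1 let B_j : ℝ^{(2k−1)d} → ℝ^d be the projection (x₁,…,x_{2k−1}) ↦ x_j, and let B_{2k} : ℝ^{(2k−1)d} → ℝ^d be (x₁,…,x_{2k−1}) ↦ Σ_{j=1}^k x_j − Σ_{j'=k+1}^{2k−1} x_{j'}. Let M = (1/(2k)') Σ_{j=1}^{2k} B_j^* B_j, where (2k)' = 2k/(2k−1). Then M is invertible, M^{−1} equals (1/(2k−1)) times the block matrix with blocks (−𝟏(k,k) + 2k·I_{kd}, 𝟏(k,k−1); 𝟏(k−1,k), −𝟏(k−1,k−1) + 2k·I_{(k−1)d}), where 𝟏(r,s) is the rd × sd block matrix all of whose d × d blocks equal I_d, and B_j M^{−1} B_j^* = I_d for each j = 1,…,2k. -/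
open MeasureTheory

/-- The maps `B_j : ℝ^{(2k-1)d} → ℝ^d` for `j = 0, …, 2k-1` (0-indexed): for `j < 2k-1` the
projection `(x₁,…,x_{2k-1}) ↦ x_{j+1}`, and for `j = 2k-1` the map
`(x₁,…,x_{2k-1}) ↦ Σ_{j=1}^k x_j − Σ_{j'=k+1}^{2k-1} x_{j'}`, given by their matrices. -/
noncomputable def Bmap (d k : ℕ) (j : Fin (2 * k)) :
    EuclideanSpace ℝ (Fin (2 * k - 1) × Fin d) →ₗ[ℝ] EuclideanSpace ℝ (Fin d) :=
  Matrix.toEuclideanLin fun (a : Fin d) (ib : Fin (2 * k - 1) × Fin d) =>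
    if a = ib.2 then
      (if (j : ℕ) < 2 * k - 1 then (if (ib.1 : ℕ) = (j : ℕ) then (1 : ℝ) else 0)
        else (if (ib.1 : ℕ) < k then (1 : ℝ) else -1))
    else 0

/-- The map `M = (1/(2k)') Σ_{j=1}^{2k} B_j^* B_j`, where `1/(2k)' = (2k-1)/(2k)`. -/
noncomputable def Mmap (d k : ℕ) :
    EuclideanSpace ℝ (Fin (2 * k - 1) × Fin d) →ₗ[ℝ]
      EuclideanSpace ℝ (Fin (2 * k - 1) × Fin d) :=
  ((2 * (k : ℝ) - 1) / (2 * (k : ℝ))) •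
    ∑ j : Fin (2 * k), (LinearMap.adjoint (Bmap d k j)).comp (Bmap d k j)

/-- The matrix of the claimed inverse of `M`:
`(1/(2k-1))` times the block matrix with blocks `(-𝟏(k,k) + 2k I_{kd}, 𝟏(k,k-1);
𝟏(k-1,k), -𝟏(k-1,k-1) + 2k I_{(k-1)d})`, where `𝟏(r,s)` consists of `d × d` identity blocks. -/
noncomputable def MinvMat (d k : ℕ) :
    Matrix (Fin (2 * k - 1) × Fin d) (Fin (2 * k - 1) × Fin d) ℝ :=
  fun ia i'b =>
    (1 / (2 * (k : ℝ) - 1)) *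
      (if ia.2 = i'b.2 then
        (2 * (k : ℝ)) * (if ia.1 = i'b.1 then 1 else 0) -
          (if (ia.1 : ℕ) < k then (1 : ℝ) else -1) * (if (i'b.1 : ℕ) < k then (1 : ℝ) else -1)
      else 0)

noncomputable def sgnv (k : ℕ) (i : Fin (2 * k - 1)) : ℝ := if (i : ℕ) < k then (1 : ℝ) else -1

noncomputable def bv (k : ℕ) (j : ℕ) (i : Fin (2 * k - 1)) : ℝ :=
  if j < 2 * k - 1 then (if (i : ℕ) = j then (1 : ℝ) else 0) else sgnv k i

noncomputable def Bm (d k j : ℕ) : Matrix (Fin d) (Fin (2 * k - 1) × Fin d) ℝ :=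
  Matrix.of fun a ib => if a = ib.2 then bv k j ib.1 else 0

noncomputable def Lift (d k : ℕ) (A : Matrix (Fin (2 * k - 1)) (Fin (2 * k - 1)) ℝ) :
    Matrix (Fin (2 * k - 1) × Fin d) (Fin (2 * k - 1) × Fin d) ℝ :=
  Matrix.of fun ia ib => if ia.2 = ib.2 then A ia.1 ib.1 else 0

lemma Lift_mul (d k : ℕ) (A B : Matrix (Fin (2 * k - 1)) (Fin (2 * k - 1)) ℝ) :
    Lift d k A * Lift d k B = Lift d k (A * B) := by
  ext ⟨i, a⟩ ⟨i', b⟩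
  simp [Lift, Matrix.mul_apply, Fintype.sum_prod_type, ite_mul, mul_ite]

lemma Lift_one (d k : ℕ) : Lift d k 1 = 1 := by
  ext ⟨i, a⟩ ⟨i', b⟩
  simp [Lift, Matrix.one_apply, Prod.ext_iff]
  split_ifs <;> simp_all

lemma sgnv_sq (k : ℕ) (i) : sgnv k i * sgnv k i = 1 := by
  unfold sgnv; split_ifs <;> norm_num

lemma sum_sgnv (k : ℕ) (hk : 0 < k) : ∑ i, sgnv k i * sgnv k i = 2 * (k : ℝ) - 1 := by
  simp only [sgnv_sq]
  simp
  rw [Nat.cast_sub (by omega)]; push_cast; ring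

noncomputable def Mm (k : ℕ) : Matrix (Fin (2 * k - 1)) (Fin (2 * k - 1)) ℝ :=
  ((2 * (k : ℝ) - 1) / (2 * (k : ℝ))) • (1 + Matrix.vecMulVec (sgnv k) (sgnv k))

noncomputable def Nm (k : ℕ) : Matrix (Fin (2 * k - 1)) (Fin (2 * k - 1)) ℝ :=
  (1 / (2 * (k : ℝ) - 1)) • ((2 * (k : ℝ)) • 1 - Matrix.vecMulVec (sgnv k) (sgnv k))

lemma vv (k : ℕ) (hk : 0 < k) : Matrix.vecMulVec (sgnv k) (sgnv k) *
    Matrix.vecMulVec (sgnv k) (sgnv k) =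
    (2 * (k : ℝ) - 1) • Matrix.vecMulVec (sgnv k) (sgnv k) := by
  ext i j
  simp only [Matrix.mul_apply, Matrix.vecMulVec_apply, Matrix.smul_apply, smul_eq_mul,
    ← sum_sgnv k hk, Finset.sum_mul]
  exact Finset.sum_congr rfl fun x _ => by ring

lemma Mm_mul_Nm (k : ℕ) (hk : 0 < k) : Mm k * Nm k = 1 := by
  have h1 : (1 : ℝ) ≤ k := by exact_mod_cast hk
  have h2 : 2 * (k : ℝ) - 1 ≠ 0 := by linarith
  have h3 : (k : ℝ) ≠ 0 := by linarith
  have : (1 + Matrix.vecMulVec (sgnv k) (sgnv k)) *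
      ((2 * (k : ℝ)) • 1 - Matrix.vecMulVec (sgnv k) (sgnv k)) = (2 * (k : ℝ)) • 1 := by
    simp only [add_mul, mul_sub, one_mul, vv k hk, mul_smul_comm, mul_one]
    module
  rw [Mm, Nm, smul_mul_smul_comm, this, smul_smul]
  convert one_smul ℝ _
  field_simp

lemma Bmap_eq (d k : ℕ) (j : Fin (2 * k)) :
    Bmap d k j = Matrix.toEuclideanLin (Bm d k j) := rfl

lemma MinvMat_eq (d k : ℕ) : MinvMat d k = Lift d k (Nm k) := by
  ext ⟨i, a⟩ ⟨i', b⟩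
  simp [MinvMat, Lift, Nm, Matrix.vecMulVec_apply, sgnv, Matrix.one_apply]

lemma BB (d k j : ℕ) : (Bm d k j).conjTranspose * Bm d k j =
    Lift d k (Matrix.vecMulVec (bv k j) (bv k j)) := by
  ext ⟨i, a⟩ ⟨i', b⟩
  simp [Bm, Lift, Matrix.mul_apply, Matrix.vecMulVec_apply, eq_comm (a := b)]

lemma sum_bv (k : ℕ) (hk : 0 < k) :
    ∑ j : Fin (2 * k), Matrix.vecMulVec (bv k j) (bv k j) =
      1 + Matrix.vecMulVec (sgnv k) (sgnv k) := by
  rw [← Finset.sum_range (fun j => Matrix.vecMulVec (bv k j) (bv k j))]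
  have hr : Finset.range (2 * k) = Finset.range ((2 * k - 1) + 1) := by
    congr 1; omega
  rw [hr, Finset.sum_range_succ]
  congr 1
  · rw [Finset.sum_range]
    ext i i'
    simp [Matrix.sum_apply, Matrix.vecMulVec_apply, bv, Matrix.one_apply, Fin.val_inj, eq_comm]
  · ext i i'
    simp [bv, Matrix.vecMulVec_apply]

lemma Mmap_eq (d k : ℕ) (hk : 0 < k) : Mmap d k = Matrix.toEuclideanLin (Lift d k (Mm k)) := by
  have h : Lift d k (Mm k) = ((2 * (k : ℝ) - 1) / (2 * (k : ℝ))) •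
      ∑ j : Fin (2 * k), (Bm d k j).conjTranspose * Bm d k j := by
    rw [Mm, ← sum_bv k hk]
    simp only [BB]
    ext ⟨i, a⟩ ⟨i', b⟩
    simp only [Lift, Matrix.of_apply, Matrix.smul_apply, Matrix.sum_apply]
    split_ifs <;> simp
  rw [h, Mmap, map_smul, map_sum]
  congr 1
  refine Finset.sum_congr rfl fun j _ => ?_
  rw [Bmap_eq, ← Matrix.toEuclideanLin_conjTranspose_eq_adjoint, Matrix.toLpLin_mul_same]

lemma BNB (d k : ℕ) (hk : 0 < k) (j : Fin (2 * k)) :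
    Bm d k j * (Lift d k (Nm k) * (Bm d k j).conjTranspose) = 1 := by
  have h1 : (1 : ℝ) ≤ k := by exact_mod_cast hk
  have h2 : 2 * (k : ℝ) - 1 ≠ 0 := by linarith
  have key : ∑ i, ∑ i', bv k j i * (Nm k i i' * bv k j i') = 1 := by
    by_cases hj : (j : ℕ) < 2 * k - 1
    · have e : ∀ i, bv k j i = if i = ⟨j, hj⟩ then 1 else 0 := by
        intro i; simp [bv, hj, Fin.ext_iff]
      simp [e, Nm, Matrix.vecMulVec_apply, sgnv_sq, h2]
    · have e : ∀ i, bv k j i = sgnv k i := by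
        intro i; simp [bv, hj]
      have e2 : ∀ i, ∑ i', sgnv k i * (Nm k i i' * sgnv k i') =
          (1 / (2 * (k : ℝ) - 1)) * (sgnv k i * sgnv k i) := by
        intro i
        have : ∀ i', sgnv k i * (Nm k i i' * sgnv k i') = (1 / (2 * (k : ℝ) - 1)) *
            ((if i = i' then 2 * (k : ℝ) * (sgnv k i * sgnv k i') else 0) -
              sgnv k i * sgnv k i * (sgnv k i' * sgnv k i')) := by
          intro i'
          simp only [Nm, Matrix.smul_apply, Matrix.sub_apply, Matrix.one_apply,
            Matrix.vecMulVec_apply, smul_eq_mul]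
          split_ifs <;> ring
        simp only [this]
        rw [← Finset.mul_sum, Finset.sum_sub_distrib, ← Finset.mul_sum, sum_sgnv k hk]
        simp
        left; ring
      simp only [e, e2]
      rw [← Finset.mul_sum, sum_sgnv k hk]
      field_simp
  ext a b
  simp only [Bm, Lift, Matrix.mul_apply, Fintype.sum_prod_type, Matrix.conjTranspose_apply,
    Matrix.of_apply, star_trivial]
  by_cases hab : a = b
  · subst hab
    simp only [Matrix.one_apply_eq]
    rw [← key]
    simp [Finset.mul_sum]
  · rw [Matrix.one_apply_ne hab]
    simp [hab, Ne.symm hab]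

/-- with `M = (1/(2k)') Σ_{j=1}^{2k} B_j^* B_j` and `(2k)' = 2k/(2k-1)`, the map
`M` is invertible with the stated block-matrix inverse, and `B_j M⁻¹ B_j^* = I_d` for each
`j = 1, …, 2k`. -/
theorem statement18 (d k : ℕ) (hd : 0 < d) (hk : 0 < k) :
    (Mmap d k).comp (Matrix.toEuclideanLin (MinvMat d k)) = LinearMap.id ∧
      (Matrix.toEuclideanLin (MinvMat d k)).comp (Mmap d k) = LinearMap.id ∧
      ∀ j : Fin (2 * k),
        (Bmap d k j).comp ((Matrix.toEuclideanLin (MinvMat d k)).comp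
          (LinearMap.adjoint (Bmap d k j))) = LinearMap.id := by
  have hMN := Mm_mul_Nm k hk
  have hNM := mul_eq_one_comm.mp hMN
  refine ⟨?_, ?_, fun j => ?_⟩
  · rw [Mmap_eq d k hk, MinvMat_eq, ← Matrix.toLpLin_mul_same, Lift_mul, hMN, Lift_one,
      Matrix.toLpLin_one]
  · rw [Mmap_eq d k hk, MinvMat_eq, ← Matrix.toLpLin_mul_same, Lift_mul, hNM, Lift_one,
      Matrix.toLpLin_one]
  · rw [Bmap_eq, MinvMat_eq, ← Matrix.toEuclideanLin_conjTranspose_eq_adjoint,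
      ← Matrix.toLpLin_mul_same, ← Matrix.toLpLin_mul_same, BNB d k hk, Matrix.toLpLin_one]
end
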